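/- arXiv:2011.01572 — 3 statements merged into one kernel-verified Lean document; each statement's English description precedes it below -/
import Mathlib

section
/- The following identities hold in 𝒜q⟦s,t⟧; after clearing denominators they constitute the entries of the Freidel–Maillet type equation R(u/v)(K(u)⊗I)R⁰(I⊗K(v)) = (I⊗K(v))R⁰(K(u)⊗I)R(u/v) for the K-matrix of the paper, so that 𝒜q has a presentation of Freidel–Maillet type: (a) [W₊(t), W₊(s)] = 0 and [W₋(t), W₋(s)] = 0; (b) [W₊(t), W₋(s)] + [W₋(t), W₊(s)] = 0; (c) (s−t)·[W₊(t), W₋(s)] = s·t·( ((q−q⁻¹)/(ρ(q+q⁻¹)))·(G₊(t)G₋(s) − G₊(s)G₋(t)) + (1/(q+q⁻¹))·(G₊(t) − G₋(t) + G₋(s) − G₊(s)) ), together with the same identity with the subscripts + and − interchanged throughout; (d) (s−t)·[G₊(t), G₋(s)] = ρ(q²−q⁻²)·(W₊(t)W₋(s) − W₊(s)W₋(t)), together with the same identity with + and − interchanged; (e) s·[G₋(s), W₊(t)]_q − t·[G₋(t), W₊(s)]_q + ρ·(s·W₊(t) − t·W₊(s)) = 0, together with the same identity with all subscripts + and − interchanged;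 (f) s·[W₋(t), G₋(s)]_q − t·[W₋(s), G₋(t)]_q + ρ·(s·W₋(t) − t·W₋(s)) = 0, together with the same identity with all subscripts + and − interchanged; (g) [G_ε(t), W_η(s)] + [W_η(t), G_ε(s)] = 0 for all ε, η ∈ {+,−}; (h) [G₊(t), G₊(s)] = 0, [G₋(t), G₋(s)] = 0, and [G₊(t), G₋(s)] + [G₋(t), G₊(s)] = 0. -/
/- STATEMENT 10: the Freidel-Maillet generating-function identities in 𝒜q⟦s,t⟧. -/

noncomputable section

namespace Alt

/-- The base field `F = ℚ(q)`. -/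
abbrev F : Type := RatFunc ℚ

/-- The indeterminate `q`. -/
def q : F := RatFunc.X

/-- Commutator `[x,y] = xy - yx`. -/
def br {A : Type*} [Ring A] (x y : A) : A := x * y - y * x

/-- `q`-commutator `[x,y]_q = q·xy - q⁻¹·yx`. -/
def qbr {A : Type*} [Ring A] [Algebra F A] (x y : A) : A :=
  q • (x * y) - q⁻¹ • (y * x)

/-- `q⁻¹`-commutator `[x,y]_{q⁻¹} = q⁻¹·xy - q·yx`. -/
def qbr' {A : Type*} [Ring A] [Algebra F A] (x y : A) : A :=
  q⁻¹ • (x * y) - q • (y * x)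

/-- Generators of the algebra `𝒜q`: `wm k ↦ W_{-k}`, `wp k ↦ W_{k+1}`,
`g k ↦ G_{k+1}`, `gt k ↦ G̃_{k+1}`. -/
inductive Gen : Type
  | wm : ℕ → Gen
  | wp : ℕ → Gen
  | g : ℕ → Gen
  | gt : ℕ → Gen

/-- The free `F`-algebra on the generators. -/
abbrev FA : Type := FreeAlgebra F Gen

/-- `W_{-k}` in the free algebra. -/
def fWm (k : ℕ) : FA := FreeAlgebra.ι F (Gen.wm k)
/-- `W_{k+1}` in the free algebra. -/
def fWp (k : ℕ) : FA := FreeAlgebra.ι F (Gen.wp k)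
/-- `G_{k+1}` in the free algebra. -/
def fG (k : ℕ) : FA := FreeAlgebra.ι F (Gen.g k)
/-- `G̃_{k+1}` in the free algebra. -/
def fGt (k : ℕ) : FA := FreeAlgebra.ι F (Gen.gt k)

/-- The defining relations of `𝒜q` (with parameter `ρ`). -/
inductive rel (ρ : F) : FA → FA → Prop
  | r1a (k : ℕ) : rel ρ (br (fWm 0) (fWp k)) ((q + q⁻¹)⁻¹ • (fGt k - fG k))
  | r1b (k : ℕ) : rel ρ (br (fWm k) (fWp 0)) ((q + q⁻¹)⁻¹ • (fGt k - fG k))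
  | r2a (k : ℕ) : rel ρ (qbr (fWm 0) (fG k)) (ρ • fWm (k + 1))
  | r2b (k : ℕ) : rel ρ (qbr (fGt k) (fWm 0)) (ρ • fWm (k + 1))
  | r3a (k : ℕ) : rel ρ (qbr (fG k) (fWp 0)) (ρ • fWp (k + 1))
  | r3b (k : ℕ) : rel ρ (qbr (fWp 0) (fGt k)) (ρ • fWp (k + 1))
  | r4a (k l : ℕ) : rel ρ (br (fWm k) (fWm l)) 0
  | r4b (k l : ℕ) : rel ρ (br (fWp k) (fWp l)) 0
  | r5 (k l : ℕ) : rel ρ (br (fWm k) (fWp l) + br (fWp k) (fWm l)) 0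
  | r6 (k l : ℕ) : rel ρ (br (fWm k) (fG l) + br (fG k) (fWm l)) 0
  | r7 (k l : ℕ) : rel ρ (br (fWm k) (fGt l) + br (fGt k) (fWm l)) 0
  | r8 (k l : ℕ) : rel ρ (br (fWp k) (fG l) + br (fG k) (fWp l)) 0
  | r9 (k l : ℕ) : rel ρ (br (fWp k) (fGt l) + br (fGt k) (fWp l)) 0
  | r10a (k l : ℕ) : rel ρ (br (fG k) (fG l)) 0
  | r10b (k l : ℕ) : rel ρ (br (fGt k) (fGt l)) 0
  | r11 (k l : ℕ) : rel ρ (br (fGt k) (fG l) + br (fG k) (fGt l)) 0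

/-- The algebra `𝒜q`: the quotient of the free algebra by the two-sided ideal
generated by the defining relations. -/
abbrev Aq (ρ : F) : Type := RingQuot (rel ρ)

/-- The generator `W_{-k}` of `𝒜q`. -/
def Wm (ρ : F) (k : ℕ) : Aq ρ := RingQuot.mkAlgHom F (rel ρ) (fWm k)
/-- The generator `W_{k+1}` of `𝒜q`. -/
def Wp (ρ : F) (k : ℕ) : Aq ρ := RingQuot.mkAlgHom F (rel ρ) (fWp k)
/-- The generator `G_{k+1}` of `𝒜q`. -/
def G (ρ : F) (k : ℕ) : Aq ρ := RingQuot.mkAlgHom F (rel ρ) (fG k)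
/-- The generator `G̃_{k+1}` of `𝒜q`. -/
def Gt (ρ : F) (k : ℕ) : Aq ρ := RingQuot.mkAlgHom F (rel ρ) (fGt k)

open scoped Classical

/-- The generating function `Σ_{k≥0} f k · x^{k+1}` in the variable `x_i`
(`i : Fin 2`; `i = 0` is `s`, `i = 1` is `t`) with coefficients in `𝒜q`. -/
def gfun (ρ : F) (i : Fin 2) (f : ℕ → Aq ρ) : MvPowerSeries (Fin 2) (Aq ρ) :=
  fun d => if 1 ≤ d i ∧ d = Finsupp.single i (d i) then f (d i - 1) else 0

/-- `W₊` in the variable `x_i`. -/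
def Wps (ρ : F) (i : Fin 2) : MvPowerSeries (Fin 2) (Aq ρ) := gfun ρ i (Wm ρ)
/-- `W₋` in the variable `x_i`. -/
def Wms (ρ : F) (i : Fin 2) : MvPowerSeries (Fin 2) (Aq ρ) := gfun ρ i (Wp ρ)
/-- `G₊` in the variable `x_i`. -/
def Gps (ρ : F) (i : Fin 2) : MvPowerSeries (Fin 2) (Aq ρ) := gfun ρ i (G ρ)
/-- `G₋` in the variable `x_i`. -/
def Gms (ρ : F) (i : Fin 2) : MvPowerSeries (Fin 2) (Aq ρ) := gfun ρ i (Gt ρ)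

/-- The variable `s`. -/
def ps (ρ : F) : MvPowerSeries (Fin 2) (Aq ρ) := MvPowerSeries.X 0
/-- The variable `t`. -/
def pt (ρ : F) : MvPowerSeries (Fin 2) (Aq ρ) := MvPowerSeries.X 1

theorem q_ne_zero : q ≠ 0 := RatFunc.X_ne_zero

theorem q_sq_ne_C (c : ℚ) : q ^ 2 - RatFunc.C c ≠ 0 := by
  have h : (Polynomial.X ^ 2 - Polynomial.C c : Polynomial ℚ) ≠ 0 :=
    Polynomial.X_pow_sub_C_ne_zero two_pos c
  have h' := RatFunc.algebraMap_ne_zero h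
  rwa [map_sub, map_pow, RatFunc.algebraMap_X, RatFunc.algebraMap_C] at h'

theorem q_sq_sub_one_ne_zero : q ^ 2 - 1 ≠ 0 := by
  simpa using q_sq_ne_C 1

theorem q_sq_add_one_ne_zero : q ^ 2 + 1 ≠ 0 := by
  simpa using q_sq_ne_C (-1)

theorem q_sub_inv_ne_zero : q - q⁻¹ ≠ 0 := by
  have h : q - q⁻¹ = (q ^ 2 - 1) * q⁻¹ := by
    have := q_ne_zero
    field_simp
  rw [h]
  exact mul_ne_zero q_sq_sub_one_ne_zero (inv_ne_zero q_ne_zero)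

theorem q_add_inv_ne_zero : q + q⁻¹ ≠ 0 := by
  have h : q + q⁻¹ = (q ^ 2 + 1) * q⁻¹ := by
    have := q_ne_zero
    field_simp
  rw [h]
  exact mul_ne_zero q_sq_add_one_ne_zero (inv_ne_zero q_ne_zero)

section Algebra

variable {K : Type*} [Field K] {A : Type*} [Ring A] [Algebra K A]

/-- The commutator `p·xy - p⁻¹·yx` with deformation parameter `p`. -/
def qcomm (p : K) (x y : A) : A := p • (x * y) - p⁻¹ • (y * x)

/-- The relations of `𝒜q` for the coefficients of `W₊, W₋, G₊, G₋`, where the two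
`W`-series have constant term `0` and the two `G`-series have constant term `ρ / (p - p⁻¹)`. -/
structure Alternating (p ρ : K) (w v g h : ℕ → A) : Prop where
  w_zero : w 0 = 0
  v_zero : v 0 = 0
  g_zero : g 0 = (ρ / (p - p⁻¹)) • 1
  h_zero : h 0 = (ρ / (p - p⁻¹)) • 1
  br_w_one_v (k : ℕ) : br (w 1) (v k) = (p + p⁻¹)⁻¹ • (h k - g k)
  br_v_one_w (k : ℕ) : br (v 1) (w k) = (p + p⁻¹)⁻¹ • (g k - h k)
  qcomm_w_one_g (k : ℕ) : qcomm p (w 1) (g k) = ρ • w (k + 1)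
  qcomm_h_w_one (k : ℕ) : qcomm p (h k) (w 1) = ρ • w (k + 1)
  qcomm_g_v_one (k : ℕ) : qcomm p (g k) (v 1) = ρ • v (k + 1)
  qcomm_v_one_h (k : ℕ) : qcomm p (v 1) (h k) = ρ • v (k + 1)
  br_w_w (k l : ℕ) : br (w k) (w l) = 0
  br_v_v (k l : ℕ) : br (v k) (v l) = 0
  br_w_v (k l : ℕ) : br (w k) (v l) + br (v k) (w l) = 0
  br_w_g (k l : ℕ) : br (w k) (g l) + br (g k) (w l) = 0
  br_w_h (k l : ℕ) : br (w k) (h l) + br (h k) (w l) = 0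
  br_v_g (k l : ℕ) : br (v k) (g l) + br (g k) (v l) = 0
  br_v_h (k l : ℕ) : br (v k) (h l) + br (h k) (v l) = 0
  br_g_g (k l : ℕ) : br (g k) (g l) = 0
  br_h_h (k l : ℕ) : br (h k) (h l) = 0
  br_h_g (k l : ℕ) : br (h k) (g l) + br (g k) (h l) = 0

theorem qcomm_smul_one_left {p : K} (hp : p - p⁻¹ ≠ 0) (ρ : K) (x : A) :
    qcomm p ((ρ / (p - p⁻¹)) • (1 : A)) x = ρ • x := by
  simp only [qcomm, smul_mul_assoc, mul_smul_comm, one_mul, mul_one, smul_smul, ← sub_smul]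
  rw [← sub_mul, mul_div_cancel₀ _ hp]

theorem qcomm_smul_one_right {p : K} (hp : p - p⁻¹ ≠ 0) (ρ : K) (x : A) :
    qcomm p x ((ρ / (p - p⁻¹)) • (1 : A)) = ρ • x := by
  simp only [qcomm, smul_mul_assoc, mul_smul_comm, one_mul, mul_one, smul_smul, ← sub_smul]
  rw [← sub_mul, mul_div_cancel₀ _ hp]

theorem br_eq_smul_sub_swap {c : K} {x y a b : A} (h : br x y = c • (a - b)) :
    br y x = c • (b - a) := by
  rw [← neg_sub a b, smul_neg, ← h, br, br, neg_sub]

theorem qcomm_left_comm (p : K) {x y : A} (hxy : br x y = 0) (z : A) :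
    qcomm p x (qcomm p y z) = qcomm p y (qcomm p x z) := by
  have hxy : x * y = y * x := sub_eq_zero.mp hxy
  have h : x * (y * z) = y * (x * z) := by rw [← mul_assoc, hxy, mul_assoc]
  simp only [qcomm, mul_sub, sub_mul, smul_sub, smul_mul_assoc, mul_smul_comm, mul_assoc, h, hxy]
  module

theorem qcomm_right_comm (p : K) {x y : A} (hxy : br x y = 0) (z : A) :
    qcomm p (qcomm p z y) x = qcomm p (qcomm p z x) y := by
  have hxy : x * y = y * x := sub_eq_zero.mp hxy
  have h : x * (y * z) = y * (x * z) := by rw [← mul_assoc, hxy, mul_assoc]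
  simp only [qcomm, mul_sub, sub_mul, smul_sub, smul_mul_assoc, mul_smul_comm, mul_assoc, h, hxy]
  module

theorem qcomm_smul_left (p c : K) (x y : A) : qcomm p (c • x) y = c • qcomm p x y := by
  simp only [qcomm, smul_mul_assoc, mul_smul_comm, smul_sub, smul_comm c]

theorem qcomm_smul_right (p c : K) (x y : A) : qcomm p x (c • y) = c • qcomm p x y := by
  simp only [qcomm, smul_mul_assoc, mul_smul_comm, smul_sub, smul_comm c]

namespace Alternating

variable {p ρ : K} {w v g h : ℕ → A}

theorem swap (H : Alternating p ρ w v g h) : Alternating p ρ v w h g where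
  w_zero := H.v_zero
  v_zero := H.w_zero
  g_zero := H.h_zero
  h_zero := H.g_zero
  br_w_one_v := H.br_v_one_w
  br_v_one_w := H.br_w_one_v
  qcomm_w_one_g := H.qcomm_v_one_h
  qcomm_h_w_one := H.qcomm_g_v_one
  qcomm_g_v_one := H.qcomm_h_w_one
  qcomm_v_one_h := H.qcomm_w_one_g
  br_w_w := H.br_v_v
  br_v_v := H.br_w_w
  br_w_v k l := by rw [add_comm]; exact H.br_w_v k l
  br_w_g := H.br_v_h
  br_w_h := H.br_v_g
  br_v_g := H.br_w_h
  br_v_h := H.br_w_g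
  br_g_g := H.br_h_h
  br_h_h := H.br_g_g
  br_h_g k l := by rw [add_comm]; exact H.br_h_g k l

theorem qcomm_h_w_symm (H : Alternating p ρ w v g h) (hρ : ρ ≠ 0) (k l : ℕ) :
    qcomm p (h k) (w (l + 1)) = qcomm p (h l) (w (k + 1)) := by
  apply smul_right_injective A hρ
  simp only [← qcomm_smul_right, ← H.qcomm_h_w_one]
  exact qcomm_left_comm p (H.br_h_h k l) _

theorem qcomm_v_h_symm (H : Alternating p ρ w v g h) (hρ : ρ ≠ 0) (k l : ℕ) :
    qcomm p (v (l + 1)) (h k) = qcomm p (v (k + 1)) (h l) := by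
  apply smul_right_injective A hρ
  simp only [← qcomm_smul_left, ← H.qcomm_v_one_h]
  exact qcomm_right_comm p (H.br_h_h k l) _

theorem br_w_v_shift (H : Alternating p ρ w v g h) (hρ : ρ ≠ 0) (hp : p ≠ 0)
    (hp' : p + p⁻¹ ≠ 0) (k l : ℕ) :
    br (w (k + 1)) (v l) - br (w k) (v (l + 1)) =
      ((p - p⁻¹) / (ρ * (p + p⁻¹))) • (g k * h l - g l * h k) := by
  have hs : p ^ 2 + 1 ≠ 0 := by
    rw [show p ^ 2 + 1 = p * (p + p⁻¹) by field_simp]; exact mul_ne_zero hp hp'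
  have mk := congrArg (br · (v l)) (H.qcomm_w_one_g k)
  have ml := congrArg (br · (v k)) (H.qcomm_w_one_g l)
  have gv₁ := congrArg (w 1 * ·) (H.br_v_g k l)
  have gv₂ := congrArg (· * w 1) (H.br_v_g k l)
  have vl₁ := congrArg (· * g k) (H.br_w_one_v l)
  have vl₂ := congrArg (g k * ·) (H.br_w_one_v l)
  have vk₁ := congrArg (· * g l) (H.br_w_one_v k)
  have vk₂ := congrArg (g l * ·) (H.br_w_one_v k)
  have wv := H.br_w_v k (l + 1)
  have gg := H.br_g_g k l
  have hg := H.br_h_g k l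
  apply smul_right_injective A hρ
  simp only [br, qcomm, mul_sub, sub_mul, mul_add, add_mul, smul_sub, smul_mul_assoc,
    mul_smul_comm, mul_assoc, mul_zero, zero_mul] at *
  linear_combination (norm := skip) ml - mk - ρ • wv + p • gv₁ - p⁻¹ • gv₂
    + p • vl₁ - p⁻¹ • vl₂ - p • vk₁ + p⁻¹ • vk₂ + gg - (p / (p + p⁻¹)) • hg
  match_scalars <;> field_simp <;> ring

theorem br_g_h_shift (H : Alternating p ρ w v g h) (hρ : ρ ≠ 0) (hp : p ≠ 0)
    (hp' : p + p⁻¹ ≠ 0) (k l : ℕ) :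
    br (g (k + 1)) (h l) - br (g k) (h (l + 1)) =
      (ρ * (p ^ (2 : ℤ) - p ^ (-2 : ℤ))) • (w (k + 1) * v (l + 1) - w (l + 1) * v (k + 1)) := by
  have hs : p ^ 2 + 1 ≠ 0 := by
    rw [show p ^ 2 + 1 = p * (p + p⁻¹) by field_simp]; exact mul_ne_zero hp hp'
  have hg := H.br_h_g k (l + 1)
  have vl := congrArg (br (g (k + 1))) (H.br_w_one_v l)
  have vk := congrArg (br (g (l + 1))) (H.br_w_one_v k)
  have gg₁ := H.br_g_g (k + 1) l
  have gg₂ := H.br_g_g (l + 1) k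
  have gv₁ := congrArg (br (w 1)) (H.br_v_g l (k + 1))
  have gv₂ := congrArg (br (w 1)) (H.br_v_g k (l + 1))
  have gv₃ := congrArg (br (w 1)) (H.swap.qcomm_h_w_symm hρ k l)
  have gv₄ := congrArg (· * w 1) (H.br_v_g l (k + 1))
  have gv₅ := congrArg (· * w 1) (H.br_v_g k (l + 1))
  have gv₆ := congrArg (· * w 1) (H.swap.qcomm_h_w_symm hρ k l)
  have mk := congrArg (br · (v l)) (H.qcomm_w_one_g (k + 1))
  have ml := congrArg (br · (v k)) (H.qcomm_w_one_g (l + 1))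
  have wv₁ := H.br_w_v_shift hρ hp hp' (k + 1) l
  have wv₂ := H.br_w_v_shift hρ hp hp' (l + 1) k
  have wv₃ := H.br_w_v (k + 1) (l + 1)
  have vl₁ := congrArg (g (k + 1) * ·) (H.br_w_one_v l)
  have vk₁ := congrArg (g (l + 1) * ·) (H.br_w_one_v k)
  have vl₂ := congrArg (g k * ·) (H.br_w_one_v (l + 1))
  have vk₂ := congrArg (g l * ·) (H.br_w_one_v (k + 1))
  have mk₁ := congrArg (· * v (l + 1)) (H.qcomm_w_one_g k)
  have ml₁ := congrArg (· * v (k + 1)) (H.qcomm_w_one_g l)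
  simp only [br, qcomm, mul_sub, sub_mul, mul_add, add_mul, smul_sub, smul_mul_assoc,
    mul_smul_comm, mul_assoc, mul_zero, zero_mul] at *
  linear_combination (norm := skip) gg₁ - gg₂ - hg - (p + p⁻¹) • vl + (p + p⁻¹) • vk
    + (p + p⁻¹) • (gv₂ - gv₁ - p • gv₃ - p⁻¹ • mk + p⁻¹ • ml
      - (p⁻¹ * ρ) • wv₁ + (p⁻¹ * ρ) • wv₂ - (p⁻¹ * ρ) • wv₃)
    + ((p + p⁻¹) * (1 - p⁻¹ ^ 2)) • (vl₁ - vk₁ - gv₄ + gv₅ - p • gv₆ + vl₂ - vk₂)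
    + ((p + p⁻¹) * (p - p⁻¹)) • (mk₁ - ml₁) - (1 - p⁻¹ ^ 2) • (gg₁ - gg₂)
  match_scalars <;> field_simp <;> ring

end Alternating

end Algebra

section Series

open MvPowerSeries

variable {K : Type*} [Field K] {A : Type*} [Ring A] [Algebra K A]

/-- The power series `Σ_k f k · x_i^k`. -/
def ser (i : Fin 2) (f : ℕ → A) : MvPowerSeries (Fin 2) A :=
  fun d => if d = Finsupp.single i (d i) then f (d i) else 0

/-- The coefficient of `t^a s^b`. -/
def cf (a b : ℕ) : MvPowerSeries (Fin 2) A →ₗ[A] A :=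
  coeff (Finsupp.single 1 a + Finsupp.single 0 b)

theorem ext_cf {φ ψ : MvPowerSeries (Fin 2) A} (h : ∀ a b, cf a b φ = cf a b ψ) : φ = ψ := by
  ext d
  have hd : d = Finsupp.single 1 (d 1) + Finsupp.single 0 (d 0) := by
    ext i; fin_cases i <;> simp
  rw [hd]
  exact h _ _

theorem cf_smul (a b : ℕ) (c : K) (φ : MvPowerSeries (Fin 2) A) :
    cf a b (c • φ) = c • cf a b φ := rfl

theorem cf_ser_one_mul_ser_zero (a b : ℕ) (f g : ℕ → A) :
    cf a b (ser 1 f * ser 0 g) = f a * g b := by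
  rw [cf, coeff_mul, Finset.sum_eq_single (Finsupp.single 1 a, Finsupp.single 0 b)]
  · simp [ser, coeff_apply]
  · rintro ⟨x, y⟩ hxy hne
    replace hxy := Finset.HasAntidiagonal.mem_antidiagonal.mp hxy
    simp only [coeff_apply, ser]
    split_ifs with hx hy <;> try simp
    refine absurd ?_ hne
    have h₀ := DFunLike.congr_fun hxy 0
    have h₁ := DFunLike.congr_fun hxy 1
    rw [hx, hy] at h₀ h₁
    simp at h₀ h₁
    rw [hx, hy, h₀, h₁]
  · intro h
    simp at h

theorem cf_ser_zero_mul_ser_one (a b : ℕ) (f g : ℕ → A) :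
    cf a b (ser 0 f * ser 1 g) = f b * g a := by
  rw [cf, coeff_mul, Finset.sum_eq_single (Finsupp.single 0 b, Finsupp.single 1 a)]
  · simp [ser, coeff_apply]
  · rintro ⟨x, y⟩ hxy hne
    replace hxy := Finset.HasAntidiagonal.mem_antidiagonal.mp hxy
    simp only [coeff_apply, ser]
    split_ifs with hx hy <;> try simp
    refine absurd ?_ hne
    have h₀ := DFunLike.congr_fun hxy 0
    have h₁ := DFunLike.congr_fun hxy 1
    rw [hx, hy] at h₀ h₁
    simp at h₀ h₁
    rw [hx, hy, h₀, h₁]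
  · intro h
    simp [add_comm] at h

theorem cf_X_zero_mul (a b : ℕ) (φ : MvPowerSeries (Fin 2) A) :
    cf a (b + 1) (X 0 * φ) = cf a b φ := by
  rw [cf, cf, Finsupp.single_add, ← add_assoc, add_comm _ (Finsupp.single 0 1), X_def,
    coeff_add_monomial_mul, one_mul]

theorem cf_X_one_mul (a b : ℕ) (φ : MvPowerSeries (Fin 2) A) :
    cf (a + 1) b (X 1 * φ) = cf a b φ := by
  rw [cf, cf, add_comm a, Finsupp.single_add, add_assoc, X_def,
    coeff_add_monomial_mul, one_mul]

theorem cf_X_zero_mul_zero (a : ℕ) (φ : MvPowerSeries (Fin 2) A) :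
    cf a 0 (X 0 * φ) = 0 := by
  rw [cf, X_def, coeff_monomial_mul, if_neg]
  intro h
  simpa using h 0

theorem cf_X_one_mul_zero (b : ℕ) (φ : MvPowerSeries (Fin 2) A) :
    cf 0 b (X 1 * φ) = 0 := by
  rw [cf, X_def, coeff_monomial_mul, if_neg]
  intro h
  simpa using h 1

/-- The series `ser i f` shifted by the constant `ρ / (p - p⁻¹)`. -/
def gser (p ρ : K) (i : Fin 2) (f : ℕ → A) : MvPowerSeries (Fin 2) A :=
  ser i f - (ρ / (p - p⁻¹)) • 1

theorem br_add_br_ser_eq_zero {f g : ℕ → A} (h : ∀ k l, br (f k) (g l) + br (g k) (f l) = 0) :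
    br (ser 1 f) (ser 0 g) + br (ser 1 g) (ser 0 f) = 0 :=
  ext_cf fun a b => by
    simpa [br, cf_ser_one_mul_ser_zero, cf_ser_zero_mul_ser_one] using h a b

theorem br_ser_eq_zero {f : ℕ → A} (h : ∀ k l, br (f k) (f l) = 0) :
    br (ser 1 f) (ser 0 f) = 0 :=
  ext_cf fun a b => by
    simpa [br, cf_ser_one_mul_ser_zero, cf_ser_zero_mul_ser_one] using h a b

theorem br_gser_left (p ρ : K) (i : Fin 2) (f : ℕ → A) (φ : MvPowerSeries (Fin 2) A) :
    br (gser p ρ i f) φ = br (ser i f) φ := by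
  simp [br, gser, sub_mul, mul_sub]

theorem br_gser_right (p ρ : K) (i : Fin 2) (f : ℕ → A) (φ : MvPowerSeries (Fin 2) A) :
    br φ (gser p ρ i f) = br φ (ser i f) := by
  simp [br, gser, sub_mul, mul_sub]

theorem qcomm_gser_left {p : K} (hp : p - p⁻¹ ≠ 0) (ρ : K) (i : Fin 2) (f : ℕ → A)
    (φ : MvPowerSeries (Fin 2) A) :
    qcomm p (gser p ρ i f) φ = qcomm p (ser i f) φ - ρ • φ := by
  rw [← qcomm_smul_one_left hp]
  simp only [qcomm, gser, sub_mul, mul_sub, smul_sub]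
  abel

theorem qcomm_gser_right {p : K} (hp : p - p⁻¹ ≠ 0) (ρ : K) (i : Fin 2) (f : ℕ → A)
    (φ : MvPowerSeries (Fin 2) A) :
    qcomm p φ (gser p ρ i f) = qcomm p φ (ser i f) - ρ • φ := by
  rw [← qcomm_smul_one_right hp]
  simp only [qcomm, gser, sub_mul, mul_sub, smul_sub]
  abel

namespace Alternating

variable {p ρ : K} {w v g h : ℕ → A}

theorem X_sub_X_mul_br_w_v (H : Alternating p ρ w v g h) (hρ : ρ ≠ 0) (hp : p ≠ 0)
    (hp' : p + p⁻¹ ≠ 0) (hp'' : p - p⁻¹ ≠ 0) :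
    (X 0 - X 1) * br (ser 1 w) (ser 0 v) =
      X 0 * X 1 * (((p - p⁻¹) / (ρ * (p + p⁻¹))) •
          (gser p ρ 1 g * gser p ρ 0 h - gser p ρ 0 g * gser p ρ 1 h) +
        (p + p⁻¹)⁻¹ • (gser p ρ 1 g - gser p ρ 1 h + gser p ρ 0 h - gser p ρ 0 g)) := by
  have hc : (p - p⁻¹) / (ρ * (p + p⁻¹)) * (ρ / (p - p⁻¹)) = (p + p⁻¹)⁻¹ := by
    generalize p - p⁻¹ = a at *
    generalize p + p⁻¹ = b at *
    field_simp
  have hG : ((p - p⁻¹) / (ρ * (p + p⁻¹))) •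
        (gser p ρ 1 g * gser p ρ 0 h - gser p ρ 0 g * gser p ρ 1 h) +
      (p + p⁻¹)⁻¹ • (gser p ρ 1 g - gser p ρ 1 h + gser p ρ 0 h - gser p ρ 0 g) =
      ((p - p⁻¹) / (ρ * (p + p⁻¹))) • (ser 1 g * ser 0 h - ser 0 g * ser 1 h) := by
    rw [← hc]
    simp only [gser, mul_sub, sub_mul, smul_mul_assoc, mul_smul_comm, one_mul, mul_one]
    module
  rw [hG, mul_assoc, sub_mul]
  refine ext_cf ?_
  rintro (_ | a) (_ | b) <;>
    simp only [map_sub, cf_X_zero_mul, cf_X_one_mul, cf_X_zero_mul_zero, cf_X_one_mul_zero, cf_smul,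
      br, cf_ser_one_mul_ser_zero, cf_ser_zero_mul_ser_one, H.w_zero, H.v_zero, mul_zero, zero_mul,
      sub_zero]
  exact H.br_w_v_shift hρ hp hp' a b

theorem X_sub_X_mul_br_g_h (H : Alternating p ρ w v g h) (hρ : ρ ≠ 0) (hp : p ≠ 0)
    (hp' : p + p⁻¹ ≠ 0) :
    (X 0 - X 1) * br (gser p ρ 1 g) (gser p ρ 0 h) =
      (ρ * (p ^ (2 : ℤ) - p ^ (-2 : ℤ))) • (ser 1 w * ser 0 v - ser 0 w * ser 1 v) := by
  rw [br_gser_left, br_gser_right, sub_mul]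
  refine ext_cf ?_
  rintro (_ | a) (_ | b) <;>
    simp only [map_sub, cf_X_zero_mul, cf_X_one_mul, cf_X_zero_mul_zero, cf_X_one_mul_zero, cf_smul,
      br, cf_ser_one_mul_ser_zero, cf_ser_zero_mul_ser_one, H.w_zero, H.v_zero, mul_zero, zero_mul,
      sub_zero]
  · simp
  · simp [H.g_zero]
  · simp [H.h_zero]
  · exact H.br_g_h_shift hρ hp hp' a b

theorem qcomm_h_w_ser (H : Alternating p ρ w v g h) (hρ : ρ ≠ 0) (hp : p - p⁻¹ ≠ 0) :
    X 0 * qcomm p (gser p ρ 0 h) (ser 1 w) - X 1 * qcomm p (gser p ρ 1 h) (ser 0 w) +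
      ρ • (X 0 * ser 1 w - X 1 * ser 0 w) = 0 := by
  have key : X 0 * qcomm p (ser 0 h) (ser 1 w) - X 1 * qcomm p (ser 1 h) (ser 0 w) = 0 := by
    refine ext_cf ?_
    rintro (_ | a) (_ | b) <;>
      simp only [map_sub, cf_X_zero_mul, cf_X_one_mul, cf_X_zero_mul_zero, cf_X_one_mul_zero,
        cf_smul, qcomm, cf_ser_one_mul_ser_zero, cf_ser_zero_mul_ser_one, H.w_zero, mul_zero,
        zero_mul, smul_zero, map_zero, sub_zero]
    exact sub_eq_zero.mpr (H.qcomm_h_w_symm hρ b a)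
  rw [qcomm_gser_left hp, qcomm_gser_left hp, mul_sub, mul_sub, mul_smul_comm, mul_smul_comm]
  linear_combination (norm := module) key

theorem qcomm_v_h_ser (H : Alternating p ρ w v g h) (hρ : ρ ≠ 0) (hp : p - p⁻¹ ≠ 0) :
    X 0 * qcomm p (ser 1 v) (gser p ρ 0 h) - X 1 * qcomm p (ser 0 v) (gser p ρ 1 h) +
      ρ • (X 0 * ser 1 v - X 1 * ser 0 v) = 0 := by
  have key : X 0 * qcomm p (ser 1 v) (ser 0 h) - X 1 * qcomm p (ser 0 v) (ser 1 h) = 0 := by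
    refine ext_cf ?_
    rintro (_ | a) (_ | b) <;>
      simp only [map_sub, cf_X_zero_mul, cf_X_one_mul, cf_X_zero_mul_zero, cf_X_one_mul_zero,
        cf_smul, qcomm, cf_ser_one_mul_ser_zero, cf_ser_zero_mul_ser_one, H.v_zero, mul_zero,
        zero_mul, smul_zero, map_zero, sub_zero]
    exact sub_eq_zero.mpr (H.qcomm_v_h_symm hρ b a)
  rw [qcomm_gser_right hp, qcomm_gser_right hp, mul_sub, mul_sub, mul_smul_comm, mul_smul_comm]
  linear_combination (norm := module) key

end Alternating

end Series

/-- The sequence `c, f 0, f 1, …`. -/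
def prepend {A : Type*} (c : A) (f : ℕ → A) : ℕ → A
  | 0 => c
  | k + 1 => f k

theorem gfun_eq_ser (ρ : F) (i : Fin 2) (f : ℕ → Aq ρ) : gfun ρ i f = ser i (prepend 0 f) := by
  funext d
  rcases hd : d i with _ | k <;> simp [gfun, ser, hd, prepend]

theorem gfun_eq_gser (ρ : F) (i : Fin 2) (f : ℕ → Aq ρ) :
    gfun ρ i f = gser q ρ i (prepend ((ρ / (q - q⁻¹)) • 1) f) := by
  rw [gfun_eq_ser, gser, eq_sub_iff_add_eq]
  ext d
  have h₁ : MvPowerSeries.coeff d ((ρ / (q - q⁻¹)) • (1 : MvPowerSeries (Fin 2) (Aq ρ))) =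
      (ρ / (q - q⁻¹)) • MvPowerSeries.coeff d 1 := rfl
  rw [map_add, h₁, MvPowerSeries.coeff_one]
  simp only [MvPowerSeries.coeff_apply, ser]
  rcases hd : d i with _ | k
  · by_cases hd₀ : d = 0 <;> simp [prepend, hd₀]
  · have hd₀ : d ≠ 0 := by rintro rfl; simp at hd
    simp [prepend, hd₀]

theorem mk_br (ρ : F) (x y : FA) : RingQuot.mkAlgHom F (rel ρ) (br x y) =
    br (RingQuot.mkAlgHom F (rel ρ) x) (RingQuot.mkAlgHom F (rel ρ) y) := by
  simp only [br, map_sub, map_mul]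

theorem mk_qbr (ρ : F) (x y : FA) : RingQuot.mkAlgHom F (rel ρ) (qbr x y) =
    qcomm q (RingQuot.mkAlgHom F (rel ρ) x) (RingQuot.mkAlgHom F (rel ρ) y) := by
  simp only [qbr, qcomm, map_sub, map_mul, map_smul]

theorem br_prepend {A : Type*} [Ring A] {x y : A} {f g : ℕ → A} (hx : ∀ z, Commute x z)
    (hy : ∀ z, Commute y z) (h : ∀ k l, br (f k) (g l) = 0) (k l : ℕ) :
    br (prepend x f k) (prepend y g l) = 0 := by
  rcases k with _ | k
  · exact sub_eq_zero.mpr (hx _)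
  · rcases l with _ | l
    · exact sub_eq_zero.mpr (hy _).symm
    · exact h k l

theorem br_prepend_add_br_prepend {A : Type*} [Ring A] {x y : A} {f g : ℕ → A}
    (hx : ∀ z, Commute x z) (hy : ∀ z, Commute y z)
    (h : ∀ k l, br (f k) (g l) + br (g k) (f l) = 0) (k l : ℕ) :
    br (prepend x f k) (prepend y g l) + br (prepend y g k) (prepend x f l) = 0 := by
  have br_left {x : A} (hx : ∀ z, Commute x z) (z : A) : br x z = 0 := sub_eq_zero.mpr (hx z)
  have br_right {x : A} (hx : ∀ z, Commute x z) (z : A) : br z x = 0 :=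
    sub_eq_zero.mpr (hx z).symm
  rcases k with _ | k
  · simp only [prepend, br_left hx, br_left hy, add_zero]
  · rcases l with _ | l
    · simp only [prepend, br_right hx, br_right hy, add_zero]
    · exact h k l

theorem alternating_generators (ρ : F) :
    Alternating q ρ (prepend 0 (Wm ρ)) (prepend 0 (Wp ρ))
      (prepend ((ρ / (q - q⁻¹)) • 1) (G ρ)) (prepend ((ρ / (q - q⁻¹)) • 1) (Gt ρ)) := by
  have mk {x y : FA} (h : rel ρ x y) := RingQuot.mkAlgHom_rel F h
  have hq := q_sub_inv_ne_zero
  have h₀ : ∀ z : Aq ρ, Commute 0 z := Commute.zero_left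
  have h₁ : ∀ z : Aq ρ, Commute ((ρ / (q - q⁻¹)) • (1 : Aq ρ)) z :=
    fun z => (Commute.one_left z).smul_left _
  have hmk : ∀ (c : F) (x : FA), RingQuot.mkAlgHom F (rel ρ) (c • x) =
      c • RingQuot.mkAlgHom F (rel ρ) x := fun c x => map_smul _ c x
  constructor
  case w_zero | v_zero | g_zero | h_zero => rfl
  case br_w_one_v =>
    rintro (_ | k)
    · simp [prepend, br]
    · simpa [mk_br, hmk] using! mk (rel.r1a k)
  case br_v_one_w =>
    rintro (_ | k)
    · simp [prepend, br]
    · have h := mk (rel.r1b k)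
      rw [mk_br, hmk, map_sub] at h
      exact br_eq_smul_sub_swap h
  case qcomm_w_one_g =>
    rintro (_ | k)
    · exact qcomm_smul_one_right hq _ _
    · simpa [mk_qbr, hmk] using! mk (rel.r2a k)
  case qcomm_h_w_one =>
    rintro (_ | k)
    · exact qcomm_smul_one_left hq _ _
    · simpa [mk_qbr, hmk] using! mk (rel.r2b k)
  case qcomm_g_v_one =>
    rintro (_ | k)
    · exact qcomm_smul_one_left hq _ _
    · simpa [mk_qbr, hmk] using! mk (rel.r3a k)
  case qcomm_v_one_h =>
    rintro (_ | k)
    · exact qcomm_smul_one_right hq _ _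
    · simpa [mk_qbr, hmk] using! mk (rel.r3b k)
  case br_w_w =>
    exact br_prepend h₀ h₀ fun k l => by simpa [mk_br] using! mk (rel.r4a k l)
  case br_v_v =>
    exact br_prepend h₀ h₀ fun k l => by simpa [mk_br] using! mk (rel.r4b k l)
  case br_g_g =>
    exact br_prepend h₁ h₁ fun k l => by simpa [mk_br] using! mk (rel.r10a k l)
  case br_h_h =>
    exact br_prepend h₁ h₁ fun k l => by simpa [mk_br] using! mk (rel.r10b k l)
  case br_w_v =>
    exact br_prepend_add_br_prepend h₀ h₀ fun k l => by simpa [mk_br] using! mk (rel.r5 k l)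
  case br_w_g =>
    exact br_prepend_add_br_prepend h₀ h₁ fun k l => by simpa [mk_br] using! mk (rel.r6 k l)
  case br_w_h =>
    exact br_prepend_add_br_prepend h₀ h₁ fun k l => by simpa [mk_br] using! mk (rel.r7 k l)
  case br_v_g =>
    exact br_prepend_add_br_prepend h₀ h₁ fun k l => by simpa [mk_br] using! mk (rel.r8 k l)
  case br_v_h =>
    exact br_prepend_add_br_prepend h₀ h₁ fun k l => by simpa [mk_br] using! mk (rel.r9 k l)
  case br_h_g =>
    exact br_prepend_add_br_prepend h₁ h₁ fun k l => by simpa [mk_br] using! mk (rel.r11 k l)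

/-- The generating-function form of the defining relations of `𝒜q`, i.e. the
entries of the Freidel-Maillet type equation, as identities in `𝒜q⟦s,t⟧`. -/
theorem statement10 (ρ : F) (hρ : ρ ≠ 0) :
    -- (a)
    (br (Wps ρ 1) (Wps ρ 0) = 0 ∧ br (Wms ρ 1) (Wms ρ 0) = 0) ∧
    -- (b)
    (br (Wps ρ 1) (Wms ρ 0) + br (Wms ρ 1) (Wps ρ 0) = 0) ∧
    -- (c)
    ((ps ρ - pt ρ) * br (Wps ρ 1) (Wms ρ 0) =
      ps ρ * pt ρ *
        (((q - q⁻¹) / (ρ * (q + q⁻¹))) •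
            (Gps ρ 1 * Gms ρ 0 - Gps ρ 0 * Gms ρ 1) +
          (q + q⁻¹)⁻¹ • (Gps ρ 1 - Gms ρ 1 + Gms ρ 0 - Gps ρ 0)) ∧
     (ps ρ - pt ρ) * br (Wms ρ 1) (Wps ρ 0) =
      ps ρ * pt ρ *
        (((q - q⁻¹) / (ρ * (q + q⁻¹))) •
            (Gms ρ 1 * Gps ρ 0 - Gms ρ 0 * Gps ρ 1) +
          (q + q⁻¹)⁻¹ • (Gms ρ 1 - Gps ρ 1 + Gps ρ 0 - Gms ρ 0))) ∧
    -- (d)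
    ((ps ρ - pt ρ) * br (Gps ρ 1) (Gms ρ 0) =
      (ρ * (q ^ (2 : ℤ) - q ^ (-2 : ℤ))) •
        (Wps ρ 1 * Wms ρ 0 - Wps ρ 0 * Wms ρ 1) ∧
     (ps ρ - pt ρ) * br (Gms ρ 1) (Gps ρ 0) =
      (ρ * (q ^ (2 : ℤ) - q ^ (-2 : ℤ))) •
        (Wms ρ 1 * Wps ρ 0 - Wms ρ 0 * Wps ρ 1)) ∧
    -- (e)
    (ps ρ * qbr (Gms ρ 0) (Wps ρ 1) - pt ρ * qbr (Gms ρ 1) (Wps ρ 0) +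
        ρ • (ps ρ * Wps ρ 1 - pt ρ * Wps ρ 0) = 0 ∧
     ps ρ * qbr (Gps ρ 0) (Wms ρ 1) - pt ρ * qbr (Gps ρ 1) (Wms ρ 0) +
        ρ • (ps ρ * Wms ρ 1 - pt ρ * Wms ρ 0) = 0) ∧
    -- (f)
    (ps ρ * qbr (Wms ρ 1) (Gms ρ 0) - pt ρ * qbr (Wms ρ 0) (Gms ρ 1) +
        ρ • (ps ρ * Wms ρ 1 - pt ρ * Wms ρ 0) = 0 ∧
     ps ρ * qbr (Wps ρ 1) (Gps ρ 0) - pt ρ * qbr (Wps ρ 0) (Gps ρ 1) +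
        ρ • (ps ρ * Wps ρ 1 - pt ρ * Wps ρ 0) = 0) ∧
    -- (g)
    (br (Gps ρ 1) (Wps ρ 0) + br (Wps ρ 1) (Gps ρ 0) = 0 ∧
     br (Gps ρ 1) (Wms ρ 0) + br (Wms ρ 1) (Gps ρ 0) = 0 ∧
     br (Gms ρ 1) (Wps ρ 0) + br (Wps ρ 1) (Gms ρ 0) = 0 ∧
     br (Gms ρ 1) (Wms ρ 0) + br (Wms ρ 1) (Gms ρ 0) = 0) ∧
    -- (h)
    (br (Gps ρ 1) (Gps ρ 0) = 0 ∧ br (Gms ρ 1) (Gms ρ 0) = 0 ∧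
     br (Gps ρ 1) (Gms ρ 0) + br (Gms ρ 1) (Gps ρ 0) = 0) := by
  have H := alternating_generators ρ
  have hq := q_ne_zero
  have hq₁ := q_add_inv_ne_zero
  have hq₂ := q_sub_inv_ne_zero
  simp only [Wps, Wms, Gps, Gms, gfun_eq_ser ρ _ (Wm ρ), gfun_eq_ser ρ _ (Wp ρ), gfun_eq_gser]
  refine ⟨⟨br_ser_eq_zero H.br_w_w, br_ser_eq_zero H.br_v_v⟩, br_add_br_ser_eq_zero H.br_w_v,
    ⟨H.X_sub_X_mul_br_w_v hρ hq hq₁ hq₂, H.swap.X_sub_X_mul_br_w_v hρ hq hq₁ hq₂⟩,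
    ⟨H.X_sub_X_mul_br_g_h hρ hq hq₁, H.swap.X_sub_X_mul_br_g_h hρ hq hq₁⟩,
    ⟨H.qcomm_h_w_ser hρ hq₂, H.swap.qcomm_h_w_ser hρ hq₂⟩,
    ⟨H.qcomm_v_h_ser hρ hq₂, H.swap.qcomm_v_h_ser hρ hq₂⟩, ?_, ?_⟩ <;>
    simp only [br_gser_left, br_gser_right]
  · refine ⟨?_, ?_, ?_, ?_⟩ <;> rw [add_comm]
    exacts [br_add_br_ser_eq_zero H.br_w_g, br_add_br_ser_eq_zero H.br_v_g,
      br_add_br_ser_eq_zero H.br_w_h, br_add_br_ser_eq_zero H.br_v_h]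
  · exact ⟨br_ser_eq_zero H.br_g_g, br_ser_eq_zero H.br_h_h, by
      rw [add_comm]; exact br_add_br_ser_eq_zero H.br_h_g⟩

end Alt
end
end

section
/- Let K : Fˣ → M₂(A) satisfy the Freidel–Maillet equation (RE), and for u ∈ Fˣ set Γ(u) = tr( P⁻ · (K(u)⊗I) · R⁰ · (I⊗K(uq)) ) ∈ A, the trace of the indicated 4×4 matrix over A. Then for all u, v ∈ Fˣ such that (v/u)² ∉ {q², q⁻²} and (v/(uq))² ∉ {q², q⁻²} (so that the matrices R(v/u) and R(v/(uq)) are invertible), the quantum determinant Γ(u) commutes with every entry of K(v): Γ(u)·K(v)_{ij} = K(v)_{ij}·Γ(u) for all i, j ∈ {1, 2}. -/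
/- STATEMENT 11: the quantum determinant Γ(u) of a solution of the Freidel-Maillet
equation commutes with all the entries of K(v). -/

set_option synthInstance.maxHeartbeats 400000

noncomputable section

namespace FM

open Kronecker

/-- The base field `F = ℚ(q)`. -/
abbrev F : Type := RatFunc ℚ

/-- The indeterminate `q`. -/
def q : F := RatFunc.X

/-- The `R`-matrix (4×4, indexed by `Fin 2 × Fin 2` in the basis
`e₁⊗e₁, e₁⊗e₂, e₂⊗e₁, e₂⊗e₂`). -/
def Rmat (z : F) : Matrix (Fin 2 × Fin 2) (Fin 2 × Fin 2) F :=
  fun p r =>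
    if p = r then (if p.1 = p.2 then z * q - z⁻¹ * q⁻¹ else z - z⁻¹)
    else if p.1 = r.2 ∧ p.2 = r.1 then q - q⁻¹ else 0

/-- The diagonal matrix `R⁰ = diag(1, q⁻¹, q⁻¹, 1)`. -/
def R0 : Matrix (Fin 2 × Fin 2) (Fin 2 × Fin 2) F :=
  Matrix.diagonal (fun p => if p.1 = p.2 then 1 else q⁻¹)

/-- The permutation matrix `P` exchanging the two middle basis vectors. -/
def Pmat : Matrix (Fin 2 × Fin 2) (Fin 2 × Fin 2) F :=
  fun p r => if p.1 = r.2 ∧ p.2 = r.1 then 1 else 0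

/-- `P⁻ = (1 - P)/2`. -/
def Pminus : Matrix (Fin 2 × Fin 2) (Fin 2 × Fin 2) F := (2⁻¹ : F) • (1 - Pmat)

variable (A : Type) [Ring A] [Algebra F A]

/-- A matrix over `F` regarded as a matrix over `A`. -/
def amap {n : Type*} (M : Matrix n n F) : Matrix n n A := M.map (algebraMap F A)

/-- `K : Fˣ → M₂(A)` satisfies the Freidel-Maillet equation (RE). -/
def SatisfiesRE (K : Fˣ → Matrix (Fin 2) (Fin 2) A) : Prop :=
  ∀ u v : Fˣ,
    amap A (Rmat ((u : F) / (v : F))) * (K u ⊗ₖ (1 : Matrix (Fin 2) (Fin 2) A)) *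
        amap A R0 * ((1 : Matrix (Fin 2) (Fin 2) A) ⊗ₖ K v) =
      ((1 : Matrix (Fin 2) (Fin 2) A) ⊗ₖ K v) * amap A R0 *
        (K u ⊗ₖ (1 : Matrix (Fin 2) (Fin 2) A)) * amap A (Rmat ((u : F) / (v : F)))

/-- `q` as a unit of `F`. -/
def qu : Fˣ := Units.mk0 q (by simpa [q] using RatFunc.X_ne_zero (K := ℚ))

/-- The quantum (Sklyanin) determinant
`Γ(u) = tr(P⁻·(K(u)⊗I)·R⁰·(I⊗K(uq)))`. -/
def Γ (K : Fˣ → Matrix (Fin 2) (Fin 2) A) (u : Fˣ) : A :=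
  Matrix.trace
    (amap A Pminus * (K u ⊗ₖ (1 : Matrix (Fin 2) (Fin 2) A)) * amap A R0 *
      ((1 : Matrix (Fin 2) (Fin 2) A) ⊗ₖ K (u * qu)))

section Exchange

variable {k : Type*} [Field k]

/-- The symmetric six-vertex matrix with weights `a`, `b`, `c`. -/
def sixVertex (a b c : k) : Matrix (Fin 2 × Fin 2) (Fin 2 × Fin 2) k :=
  fun p r =>
    if p = r then (if p.1 = p.2 then a else b)
    else if p.1 = r.2 ∧ p.2 = r.1 then c else 0

lemma sixVertex_mul (a b c a' b' c' : k) :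
    sixVertex a b c * sixVertex a' b' c' =
      sixVertex (a * a') (b * b' + c * c') (b * c' + c * b') := by
  ext ⟨i, j⟩ ⟨m, n⟩
  fin_cases i <;> fin_cases j <;> fin_cases m <;> fin_cases n <;>
    simp [Matrix.mul_apply, Fintype.sum_prod_type, sixVertex, add_comm]

lemma sixVertex_one : sixVertex (1 : k) 1 0 = 1 := by
  ext p r
  simp [sixVertex, Matrix.one_apply]

variable {B : Type*} [Ring B] [Algebra k B]

/-- A quadratic exchange relation, which moves the entries of `X` to the right of those
of `L`: the off-diagonal twist is `t`, and `(a, b, c)`, `(a', b', c')` are the six-vertex weights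
of the `R`-matrix and of its inverse. -/
def Exchange (t a b c a' b' c' : k) (L X : Matrix (Fin 2) (Fin 2) B) : Prop :=
  ∀ i j m n, X j n * L i m = (if i = n then 1 else t⁻¹ : k) •
    ∑ p : Fin 2 × Fin 2, ∑ r : Fin 2 × Fin 2,
      (sixVertex a b c (i, j) p * (if r.1 = p.2 then 1 else t) * sixVertex a' b' c' r (m, n)) •
        (L p.1 r.1 * X p.2 r.2)

lemma Exchange.mul_mul {t a b c a' b' c' : k} {L X : Matrix (Fin 2) (Fin 2) B}
    (h : Exchange t a b c a' b' c' L X)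
    (i j m n : Fin 2) (y : B) : X j n * (L i m * y) = (if i = n then 1 else t⁻¹ : k) •
    ∑ p : Fin 2 × Fin 2, ∑ r : Fin 2 × Fin 2,
      (sixVertex a b c (i, j) p * (if r.1 = p.2 then 1 else t) * sixVertex a' b' c' r (m, n)) •
        (L p.1 r.1 * (X p.2 r.2 * y)) := by
  rw [← mul_assoc, h]
  simp only [smul_mul_assoc, Finset.sum_mul, mul_assoc]

lemma commute_qdet_of_exchange {s w : k} (hs : s ≠ 0) (hw : w ≠ 0)
    {a b c d e : k}
    (h1 : a = w * s - w⁻¹ * s⁻¹) (h2 : d = w * s⁻¹ - w⁻¹ * s)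
    (h3 : e = w * s * s - w⁻¹ * s⁻¹ * s⁻¹) (h4 : b = w - w⁻¹) (h5 : c = s - s⁻¹)
    (ha : a ≠ 0) (hb : b ≠ 0) (hd : d ≠ 0) (he : e ≠ 0)
    {L L' X : Matrix (Fin 2) (Fin 2) B}
    (hL : Exchange s⁻¹ a b c a⁻¹ (b / (a * d)) (-c / (a * d)) L X)
    (hL' : Exchange s⁻¹ e a c e⁻¹ (a / (e * b)) (-c / (e * b)) L' X)
    (e1 : L 1 0 * L' 0 0 = s⁻¹ • (L 0 0 * L' 1 0))
    (e2 : L 1 1 * L' 0 1 = s • (L 0 1 * L' 1 1))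
    (e3 : L 1 1 * L' 0 0 = L 0 0 * L' 1 1 + s • (L 0 1 * L' 1 0 - L 1 0 * L' 0 1))
    (j n : Fin 2) :
    X j n * (s⁻¹ • (L 0 0 * L' 1 1) - L 1 0 * L' 0 1) =
      (s⁻¹ • (L 0 0 * L' 1 1) - L 1 0 * L' 0 1) * X j n := by
  have f1 : ∀ y, L 1 0 * (L' 0 0 * y) = s⁻¹ • (L 0 0 * (L' 1 0 * y)) := fun y => by
    rw [← mul_assoc, e1, smul_mul_assoc, mul_assoc]
  have f2 : ∀ y, L 1 1 * (L' 0 1 * y) = s • (L 0 1 * (L' 1 1 * y)) := fun y => by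
    rw [← mul_assoc, e2, smul_mul_assoc, mul_assoc]
  have f3 : ∀ y, L 1 1 * (L' 0 0 * y) =
      L 0 0 * (L' 1 1 * y) + s • (L 0 1 * (L' 1 0 * y) - L 1 0 * (L' 0 1 * y)) := fun y => by
    simp only [← mul_assoc, e3, add_mul, sub_mul, smul_mul_assoc]
  simp only [mul_sub, sub_mul, mul_smul_comm, smul_mul_assoc, hL.mul_mul, mul_assoc]
  generalize hb' : b / (a * d) = b' at *
  generalize hc' : -c / (a * d) = c' at *
  generalize hb'' : a / (e * b) = b'' at *
  generalize hc'' : -c / (e * b) = c'' at *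
  fin_cases j <;> fin_cases n <;>
    simp only [Fintype.sum_prod_type, Fin.sum_univ_two, sixVertex, Fin.zero_eta, Fin.mk_one,
      Prod.mk.injEq, zero_ne_one, one_ne_zero, and_true, and_false, true_and, false_and,
      if_true, if_false, zero_mul, mul_zero, zero_smul, add_zero, zero_add] <;>
    simp only [hL' _ _ _ _, mul_add, mul_smul_comm, Fintype.sum_prod_type, Fin.sum_univ_two,
      sixVertex, Prod.mk.injEq, zero_ne_one, one_ne_zero, and_true, and_false, true_and, false_and,
      if_true, if_false, zero_mul, mul_zero, zero_smul, add_zero, zero_add] <;>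
    simp only [f1, f2, f3]
  all_goals
    subst hb' hc' hb'' hc''
    match_scalars <;> field_simp <;> simp only [h1, h2, h3, h4, h5] <;> field_simp <;> ring

lemma eq_of_neg_smul_add_smul_eq_zero {c : k} (hc : c ≠ 0) {x y : B}
    (h : -c • x + c • y = 0) : y = x := by
  rw [neg_smul, neg_add_eq_zero] at h
  exact (smul_right_injective B hc h).symm

lemma eq_of_neg_smul_add_smul_eq {c s : k} (hc : c ≠ 0) (hs : s ≠ 0) {x x' y z n n' : B}
    (h : -c • s⁻¹ • x + c • y = -c • s⁻¹ • n + c • n')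
    (h' : -c • z + c • s⁻¹ • x' = c • s⁻¹ • n + -c • n') : x' = x + s • (z - y) := by
  apply smul_right_injective B (mul_ne_zero hc (inv_ne_zero hs))
  have hsum := congrArg₂ (· + ·) h h'
  rw [← sub_eq_zero] at hsum ⊢
  rw [← hsum]
  match_scalars <;> field_simp <;> ring

lemma half_smul_eq (h : (2 : k) ≠ 0) {s : k} (hs : s ≠ 0) {x x' y z : B}
    (hx : x' = x + s • (z - y)) :
    (2⁻¹ : k) • (s⁻¹ • x + s⁻¹ • x' - y - z) = s⁻¹ • x - y := by
  rw [hx]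
  match_scalars <;> field_simp <;> ring

end Exchange

lemma Rmat_eq_sixVertex (z : F) :
    Rmat z = sixVertex (z * q - z⁻¹ * q⁻¹) (z - z⁻¹) (q - q⁻¹) := rfl

variable {A}

lemma kronecker_one_mul_R0_mul_apply (L X : Matrix (Fin 2) (Fin 2) A) (p r : Fin 2 × Fin 2) :
    ((L ⊗ₖ (1 : Matrix (Fin 2) (Fin 2) A)) * amap A R0 *
      ((1 : Matrix (Fin 2) (Fin 2) A) ⊗ₖ X)) p r =
      (if r.1 = p.2 then 1 else q⁻¹ : F) • (L p.1 r.1 * X p.2 r.2) := by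
  obtain ⟨i, j⟩ := p
  obtain ⟨m, n⟩ := r
  fin_cases i <;> fin_cases j <;> fin_cases m <;> fin_cases n <;>
    simp [Matrix.mul_apply, Fintype.sum_prod_type, amap, R0, Matrix.one_apply,
      Matrix.diagonal_apply, Algebra.smul_def, Algebra.left_comm, mul_assoc]

lemma one_kronecker_mul_R0_mul_apply (L X : Matrix (Fin 2) (Fin 2) A) (p r : Fin 2 × Fin 2) :
    (((1 : Matrix (Fin 2) (Fin 2) A) ⊗ₖ X) * amap A R0 *
      (L ⊗ₖ (1 : Matrix (Fin 2) (Fin 2) A))) p r =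
      (if p.1 = r.2 then 1 else q⁻¹ : F) • (X p.2 r.2 * L p.1 r.1) := by
  obtain ⟨i, j⟩ := p
  obtain ⟨m, n⟩ := r
  fin_cases i <;> fin_cases j <;> fin_cases m <;> fin_cases n <;>
    simp [Matrix.mul_apply, Fintype.sum_prod_type, amap, R0, Matrix.one_apply,
      Matrix.diagonal_apply, Algebra.smul_def, Algebra.left_comm, mul_assoc]

lemma q_ne_zero : q ≠ 0 := RatFunc.X_ne_zero

lemma q_sub_inv_ne_zero : q - q⁻¹ ≠ 0 := by
  intro h
  have h1 : (RatFunc.X : F) * RatFunc.X = 1 := by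
    change q * q = 1
    have hq := q_ne_zero
    field_simp at h
    linear_combination h
  have h2 : algebraMap (Polynomial ℚ) F (Polynomial.X * Polynomial.X) =
      algebraMap (Polynomial ℚ) F 1 := by
    rw [map_mul, map_one, RatFunc.algebraMap_X, h1]
  have h3 := congrArg (Polynomial.eval 0) (RatFunc.algebraMap_injective ℚ h2)
  simp at h3

lemma SatisfiesRE.entries {K : Fˣ → Matrix (Fin 2) (Fin 2) A} (hK : SatisfiesRE A K)
    (u v : Fˣ) (p r : Fin 2 × Fin 2) :
    ∑ t, Rmat ((u : F) / v) p t •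
        ((if r.1 = t.2 then 1 else q⁻¹ : F) • (K u t.1 r.1 * K v t.2 r.2)) =
      ∑ t, Rmat ((u : F) / v) t r •
        ((if p.1 = t.2 then 1 else q⁻¹ : F) • (K v p.2 t.2 * K u p.1 t.1)) := by
  have h := congrFun₂ (hK u v) p r
  rw [Matrix.mul_assoc, Matrix.mul_assoc, ← Matrix.mul_assoc (K u ⊗ₖ 1), Matrix.mul_apply,
    Matrix.mul_apply] at h
  simp only [kronecker_one_mul_R0_mul_apply, one_kronecker_mul_R0_mul_apply] at h
  simpa only [amap, Matrix.map_apply, ← Algebra.smul_def, ← Algebra.commutes] using h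

lemma SatisfiesRE.exchange {K : Fˣ → Matrix (Fin 2) (Fin 2) A} (hK : SatisfiesRE A K)
    (u v : Fˣ) {a b c d : F} (ha : a = (u : F) / v * q - ((u : F) / v)⁻¹ * q⁻¹)
    (hb : b = (u : F) / v - ((u : F) / v)⁻¹) (hc : c = q - q⁻¹)
    (hd : d = (u : F) / v * q⁻¹ - ((u : F) / v)⁻¹ * q) (ha0 : a ≠ 0) (hd0 : d ≠ 0) :
    Exchange q⁻¹ a b c a⁻¹ (b / (a * d)) (-c / (a * d)) (K u) (K v) := by
  have key : b * b - c * c = a * d := by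
    have := q_ne_zero
    have hu := u.ne_zero
    have hv := v.ne_zero
    rw [ha, hb, hc, hd]
    field_simp
    ring
  have hinv : sixVertex a b c * sixVertex a⁻¹ (b / (a * d)) (-c / (a * d)) = 1 := by
    rw [sixVertex_mul, ← sixVertex_one]
    congr 1
    · exact mul_inv_cancel₀ ha0
    · rw [← mul_div_assoc, ← mul_div_assoc, ← add_div, div_eq_one_iff_eq (mul_ne_zero ha0 hd0),
        ← key]
      ring
    · ring
  intro i j m n
  have hR : Rmat ((u : F) / v) = sixVertex a b c := by rw [Rmat_eq_sixVertex, ha, hb, hc]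
  have h := hK u v
  rw [hR] at h
  have h' := congrArg (· * amap A (sixVertex a⁻¹ (b / (a * d)) (-c / (a * d)))) h
  have hA : amap A (sixVertex a b c) * amap A (sixVertex a⁻¹ (b / (a * d)) (-c / (a * d))) = 1 := by
    simp only [amap]
    rw [← Matrix.map_mul, hinv, Matrix.map_one _ (map_zero _) (map_one _)]
  beta_reduce at h'
  rw [Matrix.mul_assoc _ (amap A (sixVertex a b c)), hA, Matrix.mul_one, Matrix.mul_assoc,
    Matrix.mul_assoc, Matrix.mul_assoc, ← Matrix.mul_assoc (amap A R0),
    ← Matrix.mul_assoc (K u ⊗ₖ 1), ← Matrix.mul_assoc (K u ⊗ₖ 1)] at h'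
  have h2 := congrFun₂ h' (i, j) (m, n)
  rw [one_kronecker_mul_R0_mul_apply, Matrix.mul_apply] at h2
  simp only [Matrix.mul_apply (N := amap A (sixVertex a⁻¹ _ _)),
    kronecker_one_mul_R0_mul_apply] at h2
  have hs : (if i = n then 1 else q⁻¹ : F) ≠ 0 := by
    split_ifs
    exacts [one_ne_zero, inv_ne_zero q_ne_zero]
  have hs' : (if i = n then 1 else q⁻¹⁻¹ : F) = (if i = n then 1 else q⁻¹ : F)⁻¹ := by
    split_ifs <;> simp
  rw [hs', eq_inv_smul_iff₀ hs, ← h2]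
  refine Finset.sum_congr rfl fun p _ => ?_
  rw [Finset.mul_sum]
  refine Finset.sum_congr rfl fun r _ => ?_
  simp only [amap, Matrix.map_apply]
  rw [← Algebra.commutes, ← Algebra.smul_def, ← Algebra.smul_def, smul_smul, smul_smul]
  congr 1
  ring

lemma SatisfiesRE.fusion {K : Fˣ → Matrix (Fin 2) (Fin 2) A} (hK : SatisfiesRE A K)
    (u : Fˣ) :
    K u 1 0 * K (u * qu) 0 0 = q⁻¹ • (K u 0 0 * K (u * qu) 1 0) ∧
    K u 1 1 * K (u * qu) 0 1 = q • (K u 0 1 * K (u * qu) 1 1) ∧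
    K u 1 1 * K (u * qu) 0 0 = K u 0 0 * K (u * qu) 1 1 +
      q • (K u 0 1 * K (u * qu) 1 0 - K u 1 0 * K (u * qu) 0 1) := by
  have hq := q_ne_zero
  have hu := u.ne_zero
  have hw : (u : F) / (u * qu : Fˣ) = q⁻¹ := by
    simp only [Units.val_mul, qu, Units.val_mk0]
    field_simp
  have hR : Rmat ((u : F) / (u * qu : Fˣ)) = sixVertex 0 (-(q - q⁻¹)) (q - q⁻¹) := by
    rw [Rmat_eq_sixVertex, hw]
    congr 1
    · simp [hq]
    · simp
  have hc : q - q⁻¹ ≠ 0 := q_sub_inv_ne_zero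
  have h := hK.entries u (u * qu) (0, 1)
  rw [hR] at h
  have h00 := h (0, 0)
  have h11 := h (1, 1)
  have h01 := h (0, 1)
  have h10 := h (1, 0)
  simp [Fintype.sum_prod_type, sixVertex] at h00 h11 h01 h10
  rw [← neg_sub q q⁻¹] at h00 h11 h01 h10
  refine ⟨eq_of_neg_smul_add_smul_eq_zero hc h00, ?_, ?_⟩
  · rw [← eq_of_neg_smul_add_smul_eq_zero hc h11, smul_inv_smul₀ hq]
  · exact eq_of_neg_smul_add_smul_eq hc hq h01 h10

lemma SatisfiesRE.qdet_eq {K : Fˣ → Matrix (Fin 2) (Fin 2) A} (hK : SatisfiesRE A K)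
    (u : Fˣ) : Γ A K u = q⁻¹ • (K u 0 0 * K (u * qu) 1 1) - K u 1 0 * K (u * qu) 0 1 := by
  have hq := q_ne_zero
  have h : Γ A K u = (2⁻¹ : F) • (q⁻¹ • (K u 0 0 * K (u * qu) 1 1) +
      q⁻¹ • (K u 1 1 * K (u * qu) 0 0) - K u 1 0 * K (u * qu) 0 1 -
      K u 0 1 * K (u * qu) 1 0) := by
    rw [Γ, Matrix.mul_assoc, Matrix.mul_assoc, ← Matrix.mul_assoc (K u ⊗ₖ 1), Matrix.trace]
    simp only [Matrix.diag_apply, Matrix.mul_apply (M := amap A Pminus),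
      kronecker_one_mul_R0_mul_apply]
    simp only [amap, Matrix.map_apply, ← Algebra.smul_def]
    simp [Fintype.sum_prod_type, Pminus, Pmat, Matrix.one_apply]
    simp only [smul_sub, smul_add]
    abel
  rw [h, half_smul_eq two_ne_zero hq (hK.fusion u).2.2]

variable (A)

/-- If `K` satisfies (RE), then for all `u, v ∈ Fˣ` such that `R(v/u)` and
`R(v/(uq))` are invertible, the quantum determinant `Γ(u)` commutes with every
entry of `K(v)`. -/
theorem statement11 (K : Fˣ → Matrix (Fin 2) (Fin 2) A) (hK : SatisfiesRE A K)
    (u v : Fˣ)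
    (h1 : ((v : F) / (u : F)) ^ 2 ≠ q ^ 2)
    (h2 : ((v : F) / (u : F)) ^ 2 ≠ q⁻¹ ^ 2)
    (h3 : ((v : F) / ((u : F) * q)) ^ 2 ≠ q ^ 2)
    (h4 : ((v : F) / ((u : F) * q)) ^ 2 ≠ q⁻¹ ^ 2)
    (i j : Fin 2) :
    Γ A K u * K v i j = K v i j * Γ A K u := by
  have hq := q_ne_zero
  have hu := u.ne_zero
  have hv := v.ne_zero
  have hw : (u : F) / v ≠ 0 := div_ne_zero hu hv
  have hr : ((u * qu : Fˣ) : F) / v = (u : F) / v * q := by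
    simp only [Units.val_mul, qu, Units.val_mk0]
    ring
  have ha : (u : F) / v * q - ((u : F) / v)⁻¹ * q⁻¹ ≠ 0 := by
    intro h
    apply h1
    field_simp at h ⊢
    linear_combination -h
  have hd : (u : F) / v * q⁻¹ - ((u : F) / v)⁻¹ * q ≠ 0 := by
    intro h
    apply h2
    field_simp at h ⊢
    linear_combination -h
  have he : (u : F) / v * q * q - ((u : F) / v)⁻¹ * q⁻¹ * q⁻¹ ≠ 0 := by
    intro h
    apply h3
    field_simp at h ⊢
    linear_combination -h
  have hb : (u : F) / v - ((u : F) / v)⁻¹ ≠ 0 := by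
    intro h
    apply h4
    field_simp at h ⊢
    linear_combination -h
  obtain ⟨e1, e2, e3⟩ := hK.fusion u
  rw [hK.qdet_eq u]
  refine (commute_qdet_of_exchange hq hw rfl rfl rfl rfl rfl ha hb hd he
    (hK.exchange u v rfl rfl rfl rfl ha hd)
    (hK.exchange (u * qu) v ?_ ?_ rfl ?_ he hb) e1 e2 e3 i j).symm
  all_goals
    rw [hr]
    field_simp

end FM
end
end

section
/- The assignment w_{-k} ↦ 2^{1−k}·x_{k+1}⁻, w_{k+1} ↦ 2^{1−k}·x_k⁺, g_{k+1} ↦ 2^{3−k}·ε_{1,k+1}, g̃_{k+1} ↦ 2^{3−k}·ε_{2,k+1} (k ∈ ℕ, elements taken in U(ĝl₂) via the canonical map ĝl₂ → U(ĝl₂)) extends to a ℂ-algebra isomorphism from Ā onto the unital subalgebra of U(ĝl₂) generated by { x_k⁺, x_{k+1}⁻, ε_{1,k+1}, ε_{2,k+1} : k ∈ ℕ } (the right alternating subalgebra U(ĝl₂^{▷,+})). Likewise, the assignment w_{-k} ↦ 2^{1−k}·x_{-k}⁻, w_{k+1} ↦ 2^{1−k}·x_{-k-1}⁺, g_{k+1}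 ↦ 2^{3−k}·ε_{1,-k-1}, g̃_{k+1} ↦ 2^{3−k}·ε_{2,-k-1} extends to a ℂ-algebra isomorphism from Ā onto the unital subalgebra of U(ĝl₂) generated by { x_{-k}⁻, x_{-k-1}⁺, ε_{1,-k-1}, ε_{2,-k-1} : k ∈ ℕ } (the left alternating subalgebra U(ĝl₂^{◁,−})). -/
/- STATEMENT 19: Ā is isomorphic to the right (resp. left) alternating
subalgebra of U(ĝl₂). -/

noncomputable section

namespace AltGl

/-- Commutator `[x,y] = xy - yx` in an associative algebra. -/
def br {A : Type*} [Ring A] (x y : A) : A := x * y - y * x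

/-- Generators of the Lie algebra `ĝl₂`. -/
inductive GLGen : Type
  | xp : ℤ → GLGen
  | xm : ℤ → GLGen
  | e1 : ℤ → GLGen
  | e2 : ℤ → GLGen
  | c : GLGen

/-- Abbreviation in the free Lie algebra. -/
def fL (x : GLGen) : FreeLieAlgebra ℂ GLGen := FreeLieAlgebra.of ℂ x

/-- The elements of the free Lie algebra whose vanishing defines `ĝl₂`. -/
inductive isRel : FreeLieAlgebra ℂ GLGen → Prop
  | e1e1 (k l : ℤ) : isRel (⁅fL (.e1 k), fL (.e1 l)⁆ -
      (if k + l = 0 then (k : ℂ) else 0) • fL .c)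
  | e2e2 (k l : ℤ) : isRel (⁅fL (.e2 k), fL (.e2 l)⁆ -
      (if k + l = 0 then (k : ℂ) else 0) • fL .c)
  | e1e2 (k l : ℤ) : isRel ⁅fL (.e1 k), fL (.e2 l)⁆
  | e1xp (k l : ℤ) : isRel (⁅fL (.e1 k), fL (.xp l)⁆ - fL (.xp (k + l)))
  | e1xm (k l : ℤ) : isRel (⁅fL (.e1 k), fL (.xm l)⁆ + fL (.xm (k + l)))
  | e2xp (k l : ℤ) : isRel (⁅fL (.e2 k), fL (.xp l)⁆ + fL (.xp (k + l)))
  | e2xm (k l : ℤ) : isRel (⁅fL (.e2 k), fL (.xm l)⁆ - fL (.xm (k + l)))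
  | xpxm (k l : ℤ) : isRel (⁅fL (.xp k), fL (.xm l)⁆ -
      (fL (.e1 (k + l)) - fL (.e2 (k + l)) + (if k + l = 0 then (k : ℂ) else 0) • fL .c))
  | xpxp (k : ℤ) : isRel ⁅fL (.xp k), fL (.xp (k + 1))⁆
  | xmxm (k : ℤ) : isRel ⁅fL (.xm k), fL (.xm (k - 1))⁆
  | ccen (x : GLGen) : isRel ⁅fL .c, fL x⁆

/-- The Lie ideal of the free Lie algebra generated by the relations. -/
def relIdeal : LieIdeal ℂ (FreeLieAlgebra ℂ GLGen) :=
  LieSubmodule.lieSpan ℂ (FreeLieAlgebra ℂ GLGen) {x | isRel x}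

/-- The affine general Lie algebra `ĝl₂`, presented by generators and relations. -/
abbrev glhat : Type := FreeLieAlgebra ℂ GLGen ⧸ relIdeal

/-- The universal enveloping algebra `U(ĝl₂)`. -/
abbrev Ugl : Type := UniversalEnvelopingAlgebra ℂ glhat

/-- A generator of `ĝl₂`, viewed in `U(ĝl₂)`. -/
def gen (x : GLGen) : Ugl :=
  UniversalEnvelopingAlgebra.ι ℂ (LieSubmodule.Quotient.mk' relIdeal (fL x))

/-- `x_k⁺ ∈ U(ĝl₂)`. -/
def Xp (k : ℤ) : Ugl := gen (.xp k)
/-- `x_k⁻ ∈ U(ĝl₂)`. -/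
def Xm (k : ℤ) : Ugl := gen (.xm k)
/-- `ε_{1,k} ∈ U(ĝl₂)`. -/
def E1 (k : ℤ) : Ugl := gen (.e1 k)
/-- `ε_{2,k} ∈ U(ĝl₂)`. -/
def E2 (k : ℤ) : Ugl := gen (.e2 k)

/-- Generators of `Ā`: `wm k ↦ w_{-k}`, `wp k ↦ w_{k+1}`, `g k ↦ g_{k+1}`,
`gt k ↦ g̃_{k+1}`. -/
inductive Gen : Type
  | wm : ℕ → Gen
  | wp : ℕ → Gen
  | g : ℕ → Gen
  | gt : ℕ → Gen

/-- Abbreviation in the free algebra. -/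
def fg (x : Gen) : FreeAlgebra ℂ Gen := FreeAlgebra.ι ℂ x

/-- The defining relations of the algebra `Ā`. -/
inductive relA : FreeAlgebra ℂ Gen → FreeAlgebra ℂ Gen → Prop
  | a1 (k l : ℕ) : relA (br (fg (.wm l)) (fg (.wp k)))
      ((2⁻¹ : ℂ) • (fg (.gt (k + l)) - fg (.g (k + l))))
  | a2a (k l : ℕ) : relA (br (fg (.gt k)) (fg (.wm l))) ((16 : ℂ) • fg (.wm (k + l + 1)))
  | a2b (k l : ℕ) : relA (br (fg (.wm l)) (fg (.g k))) ((16 : ℂ) • fg (.wm (k + l + 1)))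
  | a3a (k l : ℕ) : relA (br (fg (.wp l)) (fg (.gt k))) ((16 : ℂ) • fg (.wp (k + l + 1)))
  | a3b (k l : ℕ) : relA (br (fg (.g k)) (fg (.wp l))) ((16 : ℂ) • fg (.wp (k + l + 1)))
  | a4a (k l : ℕ) : relA (br (fg (.wm k)) (fg (.wm l))) 0
  | a4b (k l : ℕ) : relA (br (fg (.wp k)) (fg (.wp l))) 0
  | a4c (k l : ℕ) : relA (br (fg (.g k)) (fg (.g l))) 0
  | a4d (k l : ℕ) : relA (br (fg (.gt k)) (fg (.gt l))) 0

/-- The algebra `Ā`. -/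
abbrev Abar : Type := RingQuot relA

/-- The generators of `Ā`. -/
def wm (k : ℕ) : Abar := RingQuot.mkAlgHom ℂ relA (fg (.wm k))
def wp (k : ℕ) : Abar := RingQuot.mkAlgHom ℂ relA (fg (.wp k))
def g (k : ℕ) : Abar := RingQuot.mkAlgHom ℂ relA (fg (.g k))
def gt (k : ℕ) : Abar := RingQuot.mkAlgHom ℂ relA (fg (.gt k))

section WordFiltration

open MvPolynomial

variable {A ι σ : Type*} [Ring A] [Algebra ℂ A]

/-- The span of the products of fewer than `n` members of the family `e`. -/
def wordSpan (e : ι → A) (n : ℕ) : Submodule ℂ A :=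
  Submodule.span ℂ {a | ∃ l : List ι, l.length < n ∧ (l.map e).prod = a}

theorem prod_mem_wordSpan (e : ι → A) {l : List ι} {n : ℕ} (h : l.length < n) :
    (l.map e).prod ∈ wordSpan e n :=
  Submodule.subset_span ⟨l, h, rfl⟩

theorem wordSpan_mono (e : ι → A) {m n : ℕ} (h : m ≤ n) : wordSpan e m ≤ wordSpan e n :=
  Submodule.span_mono fun _ ⟨l, hl, ha⟩ => ⟨l, hl.trans_le h, ha⟩

theorem wordSpan_zero (e : ι → A) : wordSpan e 0 = ⊥ := by
  simp [wordSpan]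

theorem mul_mem_wordSpan (e : ι → A) (i : ι) {n : ℕ} {a : A} (ha : a ∈ wordSpan e n) :
    e i * a ∈ wordSpan e (n + 1) := by
  induction ha using Submodule.span_induction with
  | mem a h =>
    obtain ⟨l, hl, rfl⟩ := h
    exact Submodule.subset_span ⟨i :: l, by simpa using hl, by simp⟩
  | zero => simp
  | add a b _ _ ha hb => rw [mul_add]; exact add_mem ha hb
  | smul t a _ ha => rw [mul_smul_comm]; exact Submodule.smul_mem _ t ha

theorem span_mul_mem_wordSpan (e : ι → A) {x : A} (hx : x ∈ Submodule.span ℂ (Set.range e))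
    {n : ℕ} {a : A} (ha : a ∈ wordSpan e n) : x * a ∈ wordSpan e (n + 1) := by
  induction hx using Submodule.span_induction with
  | mem x h => obtain ⟨i, rfl⟩ := h; exact mul_mem_wordSpan e i ha
  | zero => simp
  | add x y _ _ hx hy => rw [add_mul]; exact add_mem hx hy
  | smul t x _ hx => rw [smul_mul_assoc]; exact Submodule.smul_mem _ t hx

theorem prod_sub_prod_mem_wordSpan_of_perm {e : ι → A}
    (hcomm : ∀ i j, e i * e j - e j * e i ∈ Submodule.span ℂ (Set.range e))
    {l l' : List ι} (h : l.Perm l') :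
    (l.map e).prod - (l'.map e).prod ∈ wordSpan e l.length := by
  induction h with
  | nil => simp
  | cons x _ ih =>
    simp only [List.map_cons, List.prod_cons, ← mul_sub, List.length_cons]
    exact mul_mem_wordSpan e x ih
  | swap x y l =>
    simp only [List.map_cons, List.prod_cons, List.length_cons, ← mul_assoc, ← sub_mul]
    exact span_mul_mem_wordSpan e (hcomm y x) (prod_mem_wordSpan e (Nat.lt_succ_self _))
  | trans h₁ _ ih₁ ih₂ =>
    rw [← h₁.length_eq] at ih₂
    simpa using add_mem ih₁ ih₂

theorem exists_mem_wordSpan {e : ι → A} (htop : Algebra.adjoin ℂ (Set.range e) = ⊤) (a : A) :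
    ∃ n, a ∈ wordSpan e n := by
  have ha : a ∈ Submodule.span ℂ (Submonoid.closure (Set.range e) : Set A) := by
    rw [← Algebra.adjoin_eq_span, htop]; trivial
  induction ha using Submodule.span_induction with
  | mem a h =>
    obtain ⟨l, rfl⟩ : ∃ l : List ι, (l.map e).prod = a := by
      induction h using Submonoid.closure_induction with
      | mem a h => obtain ⟨i, rfl⟩ := h; exact ⟨[i], by simp⟩
      | one => exact ⟨[], rfl⟩
      | mul a b _ _ ha hb =>
        obtain ⟨l, rfl⟩ := ha
        obtain ⟨l', rfl⟩ := hb
        exact ⟨l ++ l', by simp⟩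
    exact ⟨_, prod_mem_wordSpan e (Nat.lt_succ_self _)⟩
  | zero => exact ⟨0, zero_mem _⟩
  | add a b _ _ ha hb =>
    obtain ⟨m, hm⟩ := ha
    obtain ⟨n, hn⟩ := hb
    exact ⟨max m n, add_mem (wordSpan_mono e (le_max_left m n) hm)
      (wordSpan_mono e (le_max_right m n) hn)⟩
  | smul t a _ ha =>
    obtain ⟨n, hn⟩ := ha
    exact ⟨n, Submodule.smul_mem _ t hn⟩

theorem derivation_mem_wordSpan
    (D : Derivation ℂ (MvPolynomial σ ℂ) (MvPolynomial σ ℂ))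
    (hD : ∀ k, D (X k) ∈ Submodule.span ℂ (Set.range X)) {n : ℕ} {p : MvPolynomial σ ℂ}
    (hp : p ∈ wordSpan X n) : D p ∈ wordSpan X n := by
  induction hp using Submodule.span_induction with
  | mem p h =>
    obtain ⟨l, hl, rfl⟩ := h
    refine wordSpan_mono X hl ?_
    clear hl
    induction l with
    | nil => simp
    | cons i l ih =>
      simp only [List.map_cons, List.prod_cons, Derivation.leibniz, smul_eq_mul,
        List.length_cons]
      refine add_mem (mul_mem_wordSpan X i ih) ?_
      rw [mul_comm]
      exact span_mul_mem_wordSpan X (hD i) (prod_mem_wordSpan X (Nat.lt_succ_self _))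
  | zero => simp
  | add p q _ _ hp hq => rw [map_add]; exact add_mem hp hq
  | smul t p _ hp => rw [D.map_smul]; exact Submodule.smul_mem _ t hp

theorem isHomogeneous_prod_X (l : List σ) :
    ((l.map X).prod : MvPolynomial σ ℂ).IsHomogeneous l.length := by
  induction l with
  | nil => simpa using isHomogeneous_one σ ℂ
  | cons i l ih =>
    simpa [add_comm] using (isHomogeneous_X ℂ i).mul ih

theorem eq_zero_of_isHomogeneous_of_mem_wordSpan {n : ℕ} {p : MvPolynomial σ ℂ}
    (hp : p.IsHomogeneous n) (h : p ∈ wordSpan X n) : p = 0 := by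
  have hle : wordSpan (X : σ → MvPolynomial σ ℂ) n ≤
      LinearMap.ker (homogeneousComponent (R := ℂ) n) := by
    refine Submodule.span_le.2 ?_
    rintro _ ⟨l, hl, rfl⟩
    have := homogeneousComponent_of_mem (m := n) (isHomogeneous_prod_X l)
    simpa [hl.ne'] using this
  simpa [homogeneousComponent_eq_self hp] using hle h

theorem aeval_smul_X_injective {c : ι → ℂ} (hc : ∀ i, c i ≠ 0) {j : ι → σ}
    (hj : Function.Injective j) :
    Function.Injective (aeval (R := ℂ) fun i => c i • (X (j i) : MvPolynomial σ ℂ)) := by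
  classical
  let r : MvPolynomial σ ℂ →ₐ[ℂ] MvPolynomial ι ℂ :=
    aeval fun s => if h : ∃ i, j i = s then (c h.choose)⁻¹ • X h.choose else 0
  have hr : r.comp (aeval fun i => c i • (X (j i) : MvPolynomial σ ℂ)) = AlgHom.id ℂ _ := by
    ext1 i
    have h : ∃ i', j i' = j i := ⟨i, rfl⟩
    have hi : h.choose = i := hj h.choose_spec
    simp only [r, AlgHom.comp_apply, aeval_X, map_smul, dif_pos h, hi, AlgHom.id_apply]
    rw [smul_smul, mul_inv_cancel₀ (hc i), one_smul]
  exact Function.LeftInverse.injective (g := r) fun p => DFunLike.congr_fun hr p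

/-- The linear map sending a commutative monomial to the product of the corresponding members of
`e`, taken in some chosen order. -/
def orderedProd (e : ι → A) : MvPolynomial ι ℂ →ₗ[ℂ] A :=
  (basisMonomials ι ℂ).constr ℂ fun m => ((Finsupp.toMultiset m).toList.map e).prod

theorem prod_sub_orderedProd_mem_wordSpan {e : ι → A}
    (hcomm : ∀ i j, e i * e j - e j * e i ∈ Submodule.span ℂ (Set.range e)) (l : List ι) :
    (l.map e).prod - orderedProd e (l.map X).prod ∈ wordSpan e l.length := by
  classical
  have hl : ((l.map X).prod : MvPolynomial ι ℂ) =
      basisMonomials ι ℂ (Multiset.toFinsupp (l : Multiset ι)) := by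
    rw [coe_basisMonomials]
    induction l with
    | nil => simp
    | cons i l ih =>
      rw [List.map_cons, List.prod_cons, ih, X, monomial_mul, one_mul, ← Multiset.cons_coe,
        ← Multiset.singleton_add, map_add, Multiset.toFinsupp_singleton]
  rw [hl, orderedProd, Module.Basis.constr_basis, Multiset.toFinsupp_toMultiset]
  refine prod_sub_prod_mem_wordSpan_of_perm hcomm ?_
  rw [← Multiset.coe_eq_coe, Multiset.coe_toList]

/-- A linear map from a filtered algebra to a polynomial ring is injective if generators act on its
values through multiplication by distinct variables, up to nonzero scalars and linear vector
fields. -/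
theorem injective_of_derivation_add_mul {e : ι → A}
    (hcomm : ∀ i j, e i * e j - e j * e i ∈ Submodule.span ℂ (Set.range e))
    (htop : Algebra.adjoin ℂ (Set.range e) = ⊤)
    (Ψ : A →ₗ[ℂ] MvPolynomial σ ℂ) (h1 : Ψ 1 = 1)
    (D : ι → Derivation ℂ (MvPolynomial σ ℂ) (MvPolynomial σ ℂ))
    (hD : ∀ i k, D i (X k) ∈ Submodule.span ℂ (Set.range X))
    {c : ι → ℂ} (hc : ∀ i, c i ≠ 0) {j : ι → σ} (hj : Function.Injective j)
    (hΨ : ∀ i a, Ψ (e i * a) = c i • (D i (Ψ a) + X (j i) * Ψ a)) :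
    Function.Injective Ψ := by
  set θ := aeval (R := ℂ) fun i => c i • (X (j i) : MvPolynomial σ ℂ) with hθ
  have hword : ∀ l : List ι, Ψ (l.map e).prod ∈ wordSpan X (l.length + 1) ∧
      Ψ (l.map e).prod - θ (l.map X).prod ∈ wordSpan X l.length := by
    intro l
    induction l with
    | nil => simpa [h1] using prod_mem_wordSpan (X : σ → MvPolynomial σ ℂ) (l := []) zero_lt_one
    | cons i l ih =>
      simp only [List.map_cons, List.prod_cons, List.length_cons, hΨ]
      have hDi := derivation_mem_wordSpan (D i) (hD i) ih.1
      refine ⟨Submodule.smul_mem _ _ (add_mem (wordSpan_mono _ (Nat.le_succ _) hDi)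
        (mul_mem_wordSpan X (j i) ih.1)), ?_⟩
      have : c i • (D i (Ψ (l.map e).prod) + X (j i) * Ψ (l.map e).prod) -
          θ (X i * (l.map X).prod) = c i • (D i (Ψ (l.map e).prod) +
            X (j i) * (Ψ (l.map e).prod - θ (l.map X).prod)) := by
        rw [map_mul, hθ, aeval_X, smul_mul_assoc, ← smul_sub, mul_sub, add_sub_assoc]
      rw [this]
      exact Submodule.smul_mem _ _ (add_mem hDi (mul_mem_wordSpan X (j i) ih.2))
  have hlead : ∀ n, ∀ a ∈ wordSpan e (n + 1), ∃ p : MvPolynomial ι ℂ, p.IsHomogeneous n ∧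
      a - orderedProd e p ∈ wordSpan e n ∧ Ψ a - θ p ∈ wordSpan X n := by
    intro n a ha
    induction ha using Submodule.span_induction with
    | mem a h =>
      obtain ⟨l, hl, rfl⟩ := h
      rcases Nat.lt_succ_iff_lt_or_eq.1 hl with hl | rfl
      · exact ⟨0, isHomogeneous_zero _ _ _, by simpa using prod_mem_wordSpan e hl,
          by simpa using wordSpan_mono _ hl (hword l).1⟩
      · exact ⟨_, isHomogeneous_prod_X l, prod_sub_orderedProd_mem_wordSpan hcomm l,
          (hword l).2⟩
    | zero => exact ⟨0, isHomogeneous_zero _ _ _, by simp, by simp⟩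
    | add a b _ _ ha hb =>
      obtain ⟨p, hp, hp1, hp2⟩ := ha
      obtain ⟨q, hq, hq1, hq2⟩ := hb
      refine ⟨p + q, hp.add hq, ?_, ?_⟩
      · rw [map_add, add_sub_add_comm]; exact add_mem hp1 hq1
      · rw [map_add, map_add, add_sub_add_comm]; exact add_mem hp2 hq2
    | smul t a _ ha =>
      obtain ⟨p, hp, hp1, hp2⟩ := ha
      refine ⟨t • p, (homogeneousSubmodule ι ℂ n).smul_mem t hp, ?_, ?_⟩
      · rw [map_smul, ← smul_sub]; exact Submodule.smul_mem _ _ hp1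
      · rw [map_smul, map_smul, ← smul_sub]; exact Submodule.smul_mem _ _ hp2
  refine (injective_iff_map_eq_zero Ψ).2 fun a ha => ?_
  obtain ⟨n, hn⟩ := exists_mem_wordSpan htop a
  induction n with
  | zero => simpa [wordSpan_zero] using hn
  | succ n ih =>
    obtain ⟨p, hp, hp1, hp2⟩ := hlead n a hn
    have hθp : θ p = 0 := by
      refine eq_zero_of_isHomogeneous_of_mem_wordSpan (n := n) ?_ (by simpa [ha] using hp2)
      simpa only [one_mul] using hp.aeval (n := 1) (fun i => c i • (X (j i) : MvPolynomial σ ℂ))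
        fun i => (homogeneousSubmodule σ ℂ 1).smul_mem _ (isHomogeneous_X ℂ (j i))
    have hp0 : p = 0 := aeval_smul_X_injective hc hj (by rw [map_zero]; exact hθp)
    exact ih (by simpa [hp0] using hp1)

end WordFiltration

section PolynomialRepresentation

attribute [local instance] LieRing.ofAssociativeRing

open MvPolynomial

/-- The first-order differential operator `∑ f z ∂/∂z + v` on the polynomial ring in the
generators of `ĝl₂`. -/
def affineOp (f : GLGen → MvPolynomial GLGen ℂ) (v : MvPolynomial GLGen ℂ) :
    Module.End ℂ (MvPolynomial GLGen ℂ) :=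
  (mkDerivation ℂ f : MvPolynomial GLGen ℂ →ₗ[ℂ] MvPolynomial GLGen ℂ) + LinearMap.mulLeft ℂ v

theorem affineOp_apply (f : GLGen → MvPolynomial GLGen ℂ) (v p : MvPolynomial GLGen ℂ) :
    affineOp f v p = mkDerivation ℂ f p + v * p := rfl

theorem affineOp_add (f f' : GLGen → MvPolynomial GLGen ℂ) (v v' : MvPolynomial GLGen ℂ) :
    affineOp f v + affineOp f' v' = affineOp (f + f') (v + v') := by
  refine LinearMap.ext fun p => ?_
  have : mkDerivation ℂ (f + f') = mkDerivation ℂ f + mkDerivation ℂ f' :=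
    derivation_ext fun i => by simp
  simp only [LinearMap.add_apply, affineOp_apply, this, Derivation.add_apply]
  ring

theorem affineOp_smul (t : ℂ) (f : GLGen → MvPolynomial GLGen ℂ) (v : MvPolynomial GLGen ℂ) :
    t • affineOp f v = affineOp (t • f) (t • v) := by
  refine LinearMap.ext fun p => ?_
  have : mkDerivation ℂ (t • f) = t • mkDerivation ℂ f :=
    derivation_ext fun i => by simp
  simp only [LinearMap.smul_apply, affineOp_apply, this, Derivation.smul_apply, smul_add,
    smul_mul_assoc]

theorem affineOp_sub (f f' : GLGen → MvPolynomial GLGen ℂ) (v v' : MvPolynomial GLGen ℂ) :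
    affineOp f v - affineOp f' v' = affineOp (f - f') (v - v') := by
  rw [sub_eq_iff_eq_add, affineOp_add, sub_add_cancel, sub_add_cancel]

theorem affineOp_zero : affineOp 0 0 = 0 := by
  simpa using (affineOp_smul 0 0 0).symm

theorem lie_affineOp (f f' : GLGen → MvPolynomial GLGen ℂ) (v v' : MvPolynomial GLGen ℂ) :
    ⁅affineOp f v, affineOp f' v'⁆ =
      affineOp (fun z => mkDerivation ℂ f (f' z) - mkDerivation ℂ f' (f z))
        (mkDerivation ℂ f v' - mkDerivation ℂ f' v) := by
  refine LinearMap.ext fun p => ?_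
  have h : mkDerivation ℂ (fun z => mkDerivation ℂ f (f' z) - mkDerivation ℂ f' (f z)) =
      ⁅mkDerivation ℂ f, mkDerivation ℂ f'⁆ :=
    derivation_ext fun i => by simp [Derivation.commutator_apply]
  simp only [Ring.lie_def, LinearMap.sub_apply, Module.End.mul_apply, affineOp_apply, h,
    Derivation.commutator_apply, map_add, Derivation.leibniz, smul_eq_mul]
  ring

/-- The product of the matrix Laurent polynomials corresponding to two generators of `ĝl₂`,
where `c` corresponds to zero. -/
def matMul : GLGen → GLGen → MvPolynomial GLGen ℂ
  | .xp k, .xm l => X (.e1 (k + l))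
  | .xp k, .e2 l => X (.xp (k + l))
  | .xm k, .xp l => X (.e2 (k + l))
  | .xm k, .e1 l => X (.xm (k + l))
  | .e1 k, .xp l => X (.xp (k + l))
  | .e1 k, .e1 l => X (.e1 (k + l))
  | .e2 k, .xm l => X (.xm (k + l))
  | .e2 k, .e2 l => X (.e2 (k + l))
  | _, _ => 0

/-- The matrix Laurent polynomial corresponding to a generator of `ĝl₂`. -/
def matVar : GLGen → MvPolynomial GLGen ℂ
  | .c => 0
  | x => X x

/-- The operator by which a generator of `ĝl₂` acts on polynomials: left matrix multiplication,
extended to a derivation, plus multiplication by the corresponding variable. -/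
def genOp (x : GLGen) : Module.End ℂ (MvPolynomial GLGen ℂ) := affineOp (matMul x) (matVar x)

theorem matMul_mem_span (x y : GLGen) :
    matMul x y ∈ Submodule.span ℂ (Set.range (X : GLGen → MvPolynomial GLGen ℂ)) := by
  cases x <;> cases y <;> simp only [matMul] <;>
    first
      | exact zero_mem _
      | exact Submodule.subset_span (Set.mem_range_self _)

theorem genOp_c : genOp .c = 0 := by
  rw [genOp, ← affineOp_zero]
  refine congrArg₂ affineOp ?_ rfl
  funext z
  cases z <;> simp [matMul]

theorem lift_genOp_of_isRel {r : FreeLieAlgebra ℂ GLGen} (hr : isRel r) :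
    FreeLieAlgebra.lift ℂ genOp r = 0 := by
  cases hr <;>
    simp only [fL, map_sub, map_add, map_smul, LieHom.map_lie, FreeLieAlgebra.lift_of_apply,
      genOp_c, smul_zero, sub_zero, add_zero, zero_lie] <;>
    simp only [genOp, lie_affineOp, affineOp_add, affineOp_sub] <;>
    rw [← affineOp_zero] <;>
    congr 1 <;>
    first
      | (funext z; cases z <;>
          simp [matMul, mkDerivation_X, add_left_comm, add_comm])
      | simp [matVar, matMul, mkDerivation_X, add_comm]

theorem relIdeal_le_ker : relIdeal ≤ (FreeLieAlgebra.lift ℂ genOp).ker :=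
  LieSubmodule.lieSpan_le.2 fun _ hr => LieHom.mem_ker.2 (lift_genOp_of_isRel hr)

/-- The representation of `ĝl₂` on polynomials in its generators. -/
def polyRep : glhat →ₗ⁅ℂ⁆ Module.End ℂ (MvPolynomial GLGen ℂ) :=
  { relIdeal.toSubmodule.liftQ (FreeLieAlgebra.lift ℂ genOp).toLinearMap
      fun _ hx => LieHom.mem_ker.1 (relIdeal_le_ker hx) with
    map_lie' := by
      intro x y
      obtain ⟨x, rfl⟩ := LieSubmodule.Quotient.surjective_mk' relIdeal x
      obtain ⟨y, rfl⟩ := LieSubmodule.Quotient.surjective_mk' relIdeal y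
      exact LieHom.map_lie (FreeLieAlgebra.lift ℂ genOp) x y }

/-- The action of `U(ĝl₂)` on polynomials. -/
def polyAction : Ugl →ₐ[ℂ] Module.End ℂ (MvPolynomial GLGen ℂ) :=
  UniversalEnvelopingAlgebra.lift ℂ polyRep

theorem polyAction_gen (x : GLGen) : polyAction (gen x) = genOp x := by
  rw [polyAction, gen, UniversalEnvelopingAlgebra.lift_ι_apply]
  exact FreeLieAlgebra.lift_of_apply genOp x

end PolynomialRepresentation

section UglRelations

attribute [local instance] LieRing.ofAssociativeRing

/-- The canonical map from the free Lie algebra to `U(ĝl₂)`. -/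
def freeToUgl : FreeLieAlgebra ℂ GLGen →ₗ⁅ℂ⁆ Ugl :=
  (UniversalEnvelopingAlgebra.ι ℂ).comp
    { (LieSubmodule.Quotient.mk' relIdeal : FreeLieAlgebra ℂ GLGen →ₗ[ℂ] glhat) with
      map_lie' := fun {_ _} => rfl }

theorem freeToUgl_fL (x : GLGen) : freeToUgl (fL x) = gen x := rfl

theorem freeToUgl_of_isRel {r : FreeLieAlgebra ℂ GLGen} (hr : isRel r) : freeToUgl r = 0 := by
  have : LieSubmodule.Quotient.mk' relIdeal r = 0 :=
    (LieSubmodule.Quotient.mk_eq_zero _).2 (LieSubmodule.subset_lieSpan hr)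
  change UniversalEnvelopingAlgebra.ι ℂ (LieSubmodule.Quotient.mk' relIdeal r) = 0
  rw [this, map_zero]

theorem lie_E1_E1 {k l : ℤ} (h : k + l ≠ 0) : ⁅E1 k, E1 l⁆ = 0 := by
  simpa [freeToUgl_fL, h, E1] using freeToUgl_of_isRel (.e1e1 k l)

theorem lie_E2_E2 {k l : ℤ} (h : k + l ≠ 0) : ⁅E2 k, E2 l⁆ = 0 := by
  simpa [freeToUgl_fL, h, E2] using freeToUgl_of_isRel (.e2e2 k l)

theorem lie_E1_Xp (k l : ℤ) : ⁅E1 k, Xp l⁆ = Xp (k + l) := by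
  simpa [freeToUgl_fL, sub_eq_zero, E1, Xp] using freeToUgl_of_isRel (.e1xp k l)

theorem lie_E1_Xm (k l : ℤ) : ⁅E1 k, Xm l⁆ = -Xm (k + l) := by
  simpa [freeToUgl_fL, add_eq_zero_iff_eq_neg, E1, Xm] using freeToUgl_of_isRel (.e1xm k l)

theorem lie_E2_Xp (k l : ℤ) : ⁅E2 k, Xp l⁆ = -Xp (k + l) := by
  simpa [freeToUgl_fL, add_eq_zero_iff_eq_neg, E2, Xp] using freeToUgl_of_isRel (.e2xp k l)

theorem lie_E2_Xm (k l : ℤ) : ⁅E2 k, Xm l⁆ = Xm (k + l) := by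
  simpa [freeToUgl_fL, sub_eq_zero, E2, Xm] using freeToUgl_of_isRel (.e2xm k l)

theorem lie_Xp_Xm {k l : ℤ} (h : k + l ≠ 0) : ⁅Xp k, Xm l⁆ = E1 (k + l) - E2 (k + l) := by
  simpa [freeToUgl_fL, sub_eq_zero, h, Xp, Xm, E1, E2] using freeToUgl_of_isRel (.xpxm k l)

/-- A family of elements on which a loop of operators acts by shifting indices commutes as soon
as neighbouring members do. -/
theorem lie_eq_zero_of_shift {x e : ℤ → Ugl} (he : ∀ k l, ⁅e k, x l⁆ = x (k + l))
    (hx : ∀ k, ⁅x k, x (k + 1)⁆ = 0) (k l : ℤ) : ⁅x k, x l⁆ = 0 := by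
  have key : ∀ k m, ⁅x (k + m), x (k + 1)⁆ = ⁅x (k + 1 + m), x k⁆ := by
    intro k m
    have h := leibniz_lie (e m) (x k) (x (k + 1))
    rw [hx, lie_zero, he, he, ← lie_skew (x k)] at h
    rw [add_comm k m, add_comm (k + 1) m]
    rwa [eq_comm, ← sub_eq_add_neg, sub_eq_zero] at h
  have shift : ∀ (n : ℕ) (a b : ℤ), ⁅x a, x b⁆ = ⁅x (a + n), x (b - n)⁆ := by
    intro n
    induction n with
    | zero => simp
    | succ n ih =>
      intro a b
      have h := key (b - n - 1) (a - b + 2 * n + 1)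
      rw [ih a b]
      convert h using 3 <;> push_cast <;> ring_nf
  have comm : ∀ a b : ℤ, a ≤ b → ⁅x a, x b⁆ = 0 := by
    intro a b hab
    have h := shift (b - a).toNat a b
    rw [Int.toNat_of_nonneg (sub_nonneg.2 hab), add_sub_cancel, sub_sub_cancel,
      ← lie_skew (x b)] at h
    refine (smul_eq_zero_iff_right (two_ne_zero (α := ℂ))).1 ?_
    rw [two_smul]
    exact eq_neg_iff_add_eq_zero.1 h
  rcases le_total k l with h | h
  · exact comm k l h
  · rw [← lie_skew, comm l k h, neg_zero]

theorem lie_Xp_Xp (k l : ℤ) : ⁅Xp k, Xp l⁆ = 0 :=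
  lie_eq_zero_of_shift lie_E1_Xp
    (fun k => by simpa [freeToUgl_fL, Xp] using freeToUgl_of_isRel (.xpxp k)) k l

theorem lie_Xm_Xm (k l : ℤ) : ⁅Xm k, Xm l⁆ = 0 :=
  lie_eq_zero_of_shift lie_E2_Xm
    (fun k => by
      have h : ⁅Xm (k + 1), Xm k⁆ = 0 := by
        simpa [freeToUgl_fL, Xm] using freeToUgl_of_isRel (.xmxm (k + 1))
      rw [← lie_skew, h, neg_zero]) k l

end UglRelations

section Homomorphism

attribute [local instance] LieRing.ofAssociativeRing

/-- The generators of `Ā`, as a family. -/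
def abarGen (x : Gen) : Abar := RingQuot.mkAlgHom ℂ relA (fg x)

theorem br_eq_of_relA {x y : Gen} {r : FreeAlgebra ℂ Gen} (h : relA (br (fg x) (fg y)) r) :
    abarGen x * abarGen y - abarGen y * abarGen x = RingQuot.mkAlgHom ℂ relA r := by
  simpa [br, abarGen] using RingQuot.mkAlgHom_rel ℂ h

theorem adjoin_abarGen : Algebra.adjoin ℂ (Set.range abarGen) = ⊤ := by
  have h : Set.range abarGen = RingQuot.mkAlgHom ℂ relA '' Set.range (FreeAlgebra.ι ℂ) := by
    rw [← Set.range_comp]; rfl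
  rw [h, ← AlgHom.map_adjoin, FreeAlgebra.adjoin_range_ι, Algebra.map_top,
    AlgHom.range_eq_top]
  exact RingQuot.mkAlgHom_surjective ℂ relA

theorem lie_eq_zero_of_lie_triple {A : Type*} [Ring A] [Algebra ℂ A] {x s t w w' v v' d : A}
    (hwv : ⁅w, v⁆ = (2⁻¹ : ℂ) • (t - s)) (hwx : ⁅w, x⁆ = (16 : ℂ) • w')
    (hxv : ⁅x, v⁆ = (16 : ℂ) • v') (hwv' : ⁅w, v'⁆ = d) (hw'v : ⁅w', v⁆ = d)
    (hxs : ⁅x, s⁆ = 0) : ⁅x, t⁆ = 0 := by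
  have h := leibniz_lie x w v
  rw [← lie_skew x w, hwx, hxv, hwv, neg_lie, smul_lie, lie_smul, lie_smul, lie_sub, hwv', hw'v,
    hxs, sub_zero, neg_add_cancel] at h
  exact (smul_eq_zero_iff_right (inv_ne_zero two_ne_zero)).1 h

theorem lie_g_gt (k l : ℕ) : ⁅abarGen (.g k), abarGen (.gt l)⁆ = 0 := by
  have h1 := br_eq_of_relA (.a1 l 0)
  have h2 := br_eq_of_relA (.a2b k 0)
  have h3 := br_eq_of_relA (.a3b k l)
  have h4 := br_eq_of_relA (.a1 (k + l + 1) 0)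
  have h5 := br_eq_of_relA (.a1 l (k + 1))
  have h6 := br_eq_of_relA (.a4c k l)
  simp only [← Ring.lie_def, map_smul, map_sub, map_zero, add_zero] at h1 h2 h3 h4 h5 h6
  change _ = (2⁻¹ : ℂ) • (abarGen (.gt l) - abarGen (.g l)) at h1
  change _ = (16 : ℂ) • abarGen (.wm (k + 1)) at h2
  change _ = (16 : ℂ) • abarGen (.wp (k + l + 1)) at h3
  change _ = (2⁻¹ : ℂ) • (abarGen (.gt (k + l + 1)) - abarGen (.g (k + l + 1))) at h4
  change _ = (2⁻¹ : ℂ) • (abarGen (.gt (l + (k + 1))) - abarGen (.g (l + (k + 1)))) at h5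
  rw [show l + (k + 1) = k + l + 1 by ring] at h5
  exact lie_eq_zero_of_lie_triple h1 h2 h3 h4 h5 h6

theorem abarGen_comm_mem_span (x y : Gen) :
    abarGen x * abarGen y - abarGen y * abarGen x ∈
      Submodule.span ℂ (Set.range abarGen) := by
  have key : ∀ z, RingQuot.mkAlgHom ℂ relA (fg z) ∈ Submodule.span ℂ (Set.range abarGen) :=
    fun z => Submodule.subset_span ⟨z, rfl⟩
  have hswap : ∀ {x y : Gen}, abarGen x * abarGen y - abarGen y * abarGen x ∈
      Submodule.span ℂ (Set.range abarGen) → abarGen y * abarGen x - abarGen x * abarGen y ∈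
      Submodule.span ℂ (Set.range abarGen) := fun h => by
    rw [← neg_sub]; exact neg_mem h
  have hrel : ∀ {x y : Gen} {r : FreeAlgebra ℂ Gen}, relA (br (fg x) (fg y)) r →
      RingQuot.mkAlgHom ℂ relA r ∈ Submodule.span ℂ (Set.range abarGen) →
      abarGen x * abarGen y - abarGen y * abarGen x ∈
        Submodule.span ℂ (Set.range abarGen) := fun h hr => by
    rw [br_eq_of_relA h]; exact hr
  have hsmul : ∀ (t : ℂ) z, RingQuot.mkAlgHom ℂ relA (t • fg z) ∈
      Submodule.span ℂ (Set.range abarGen) := fun t z => by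
    rw [map_smul]; exact Submodule.smul_mem _ t (key z)
  have hzero : RingQuot.mkAlgHom ℂ relA 0 ∈ Submodule.span ℂ (Set.range abarGen) := by
    rw [map_zero]; exact zero_mem _
  have hw : ∀ k l, abarGen (.wm l) * abarGen (.wp k) - abarGen (.wp k) * abarGen (.wm l) ∈
      Submodule.span ℂ (Set.range abarGen) := fun k l => hrel (.a1 k l) <| by
    rw [map_smul, map_sub]
    exact Submodule.smul_mem _ _ (sub_mem (key _) (key _))
  have hg : ∀ k l, abarGen (.g k) * abarGen (.gt l) - abarGen (.gt l) * abarGen (.g k) ∈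
      Submodule.span ℂ (Set.range abarGen) := fun k l => by
    rw [← Ring.lie_def, lie_g_gt]; exact zero_mem _
  rcases x with k | k | k | k <;> rcases y with l | l | l | l
  · exact hrel (.a4a k l) hzero
  · exact hw l k
  · exact hrel (.a2b l k) (hsmul _ _)
  · exact hswap (hrel (.a2a l k) (hsmul _ _))
  · exact hswap (hw k l)
  · exact hrel (.a4b k l) hzero
  · exact hswap (hrel (.a3b l k) (hsmul _ _))
  · exact hrel (.a3a l k) (hsmul _ _)
  · exact hswap (hrel (.a2b k l) (hsmul _ _))
  · exact hrel (.a3b k l) (hsmul _ _)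
  · exact hrel (.a4c k l) hzero
  · exact hg k l
  · exact hrel (.a2a k l) (hsmul _ _)
  · exact hswap (hrel (.a3a k l) (hsmul _ _))
  · exact hswap (hg l k)
  · exact hrel (.a4d k l) hzero

/-- A homomorphism from `Ā` to `U(ĝl₂)` is injective if it sends the generators of `Ā` to nonzero
multiples of distinct noncentral generators of `ĝl₂`. -/
theorem injective_of_apply_abarGen (φ : Abar →ₐ[ℂ] Ugl) {c : Gen → ℂ} (hc : ∀ x, c x ≠ 0)
    {j : Gen → GLGen} (hj : Function.Injective j) (hjc : ∀ x, j x ≠ .c)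
    (hφ : ∀ x, φ (abarGen x) = c x • gen (j x)) : Function.Injective φ := by
  let Ψ : Abar →ₗ[ℂ] MvPolynomial GLGen ℂ :=
    (LinearMap.applyₗ 1).comp ((polyAction.comp φ).toLinearMap)
  have hΨ : ∀ a, Ψ a = polyAction (φ a) 1 := fun _ => rfl
  have hinj : Function.Injective Ψ := by
    refine injective_of_derivation_add_mul abarGen_comm_mem_span adjoin_abarGen Ψ
      (by simp [hΨ]) (fun x => MvPolynomial.mkDerivation ℂ (matMul (j x)))
      (fun x y => by simpa using matMul_mem_span (j x) y) hc hj fun x a => ?_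
    have hv : matVar (j x) = MvPolynomial.X (j x) := by
      have := hjc x
      cases hx : j x <;> simp_all [matVar]
    rw [hΨ, hΨ, map_mul, hφ, map_mul, map_smul, polyAction_gen, Module.End.mul_apply,
      LinearMap.smul_apply, genOp, affineOp_apply, hv]
  exact fun a b hab => hinj (by rw [hΨ, hΨ, hab])

/-- A family of nonzero multiples of noncentral generators of `ĝl₂` satisfying the relations of
`Ā` determines an isomorphism from `Ā` onto the subalgebra they generate. -/
theorem exists_injective_algHom {c : Gen → ℂ} (hc : ∀ x, c x ≠ 0)
    {j : Gen → GLGen} (hj : Function.Injective j) (hjc : ∀ x, j x ≠ .c)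
    (hrel : ∀ ⦃a b⦄, relA a b → FreeAlgebra.lift ℂ (fun x => c x • gen (j x)) a =
      FreeAlgebra.lift ℂ (fun x => c x • gen (j x)) b) :
    ∃ φ : Abar →ₐ[ℂ] Ugl, Function.Injective φ ∧ (∀ x, φ (abarGen x) = c x • gen (j x)) ∧
      φ.range = Algebra.adjoin ℂ (Set.range fun x => gen (j x)) := by
  let φ : Abar →ₐ[ℂ] Ugl :=
    RingQuot.liftAlgHom ℂ ⟨FreeAlgebra.lift ℂ fun x => c x • gen (j x), hrel⟩
  have hφ : ∀ x, φ (abarGen x) = c x • gen (j x) := fun x => by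
    simp only [φ, abarGen, RingQuot.liftAlgHom_mkAlgHom_apply, fg, FreeAlgebra.lift_ι_apply]
  refine ⟨φ, injective_of_apply_abarGen φ hc hj hjc hφ, hφ, ?_⟩
  rw [← Algebra.map_top, ← adjoin_abarGen, AlgHom.map_adjoin, ← Set.range_comp]
  refine le_antisymm (Algebra.adjoin_le ?_) (Algebra.adjoin_le ?_)
  · rintro _ ⟨x, rfl⟩
    rw [Function.comp_apply, hφ]
    exact Subalgebra.smul_mem _
      (Algebra.subset_adjoin (Set.mem_range_self (f := fun x => gen (j x)) x)) _
  · rintro _ ⟨x, rfl⟩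
    have h := Subalgebra.smul_mem _ (Algebra.subset_adjoin (R := ℂ)
      (Set.mem_range_self (f := φ ∘ abarGen) x)) (c x)⁻¹
    rwa [Function.comp_apply, hφ, smul_smul, inv_mul_cancel₀ (hc x), one_smul] at h

/-- The scalars in the isomorphisms between `Ā` and the alternating subalgebras. -/
def altScalar : Gen → ℂ
  | .wm k => 2 ^ (1 - (k : ℤ))
  | .wp k => 2 ^ (1 - (k : ℤ))
  | .g k => 2 ^ (3 - (k : ℤ))
  | .gt k => 2 ^ (3 - (k : ℤ))

theorem altScalar_ne_zero (x : Gen) : altScalar x ≠ 0 := by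
  cases x <;> exact zpow_ne_zero _ two_ne_zero

/-- The generators of the right alternating subalgebra. -/
def rightGen : Gen → GLGen
  | .wm k => .xm (k + 1)
  | .wp k => .xp k
  | .g k => .e1 (k + 1)
  | .gt k => .e2 (k + 1)

/-- The generators of the left alternating subalgebra. -/
def leftGen : Gen → GLGen
  | .wm k => .xm (-k)
  | .wp k => .xp (-k - 1)
  | .g k => .e1 (-k - 1)
  | .gt k => .e2 (-k - 1)

theorem rightGen_injective : Function.Injective rightGen := by
  intro x y h
  cases x <;> cases y <;> simp_all [rightGen]

theorem leftGen_injective : Function.Injective leftGen := by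
  intro x y h
  cases x <;> cases y <;> simp_all [leftGen]

theorem two_zpow_mul_two_zpow (a b : ℤ) : (2 : ℂ) ^ a * 2 ^ b = 2 ^ (a + b) :=
  (zpow_add₀ two_ne_zero a b).symm

theorem two_inv_mul_two_zpow (a : ℤ) : (2 : ℂ)⁻¹ * 2 ^ a = 2 ^ (a - 1) := by
  rw [zpow_sub_one₀ two_ne_zero, mul_comm]

theorem sixteen_mul_two_zpow (a : ℤ) : (16 : ℂ) * 2 ^ a = 2 ^ (4 + a) := by
  rw [zpow_add₀ two_ne_zero]; norm_num

/-- The images of the generators of `Ā` satisfy its relations as soon as they satisfy the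
relations of the loop algebra with the appropriate indices. -/
theorem lift_eq_of_relA {j : Gen → GLGen}
    (hwp : ∀ k l, ⁅gen (j (.wp k)), gen (j (.wm l))⁆ =
      gen (j (.g (k + l))) - gen (j (.gt (k + l))))
    (hgtwm : ∀ k l, ⁅gen (j (.gt k)), gen (j (.wm l))⁆ = gen (j (.wm (k + l + 1))))
    (hgwm : ∀ k l, ⁅gen (j (.g k)), gen (j (.wm l))⁆ = -gen (j (.wm (k + l + 1))))
    (hgtwp : ∀ k l, ⁅gen (j (.gt k)), gen (j (.wp l))⁆ = -gen (j (.wp (k + l + 1))))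
    (hgwp : ∀ k l, ⁅gen (j (.g k)), gen (j (.wp l))⁆ = gen (j (.wp (k + l + 1))))
    (hwmwm : ∀ k l, ⁅gen (j (.wm k)), gen (j (.wm l))⁆ = 0)
    (hwpwp : ∀ k l, ⁅gen (j (.wp k)), gen (j (.wp l))⁆ = 0)
    (hgg : ∀ k l, ⁅gen (j (.g k)), gen (j (.g l))⁆ = 0)
    (hgtgt : ∀ k l, ⁅gen (j (.gt k)), gen (j (.gt l))⁆ = 0)
    ⦃a b : FreeAlgebra ℂ Gen⦄ (h : relA a b) :
    FreeAlgebra.lift ℂ (fun x => altScalar x • gen (j x)) a =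
      FreeAlgebra.lift ℂ (fun x => altScalar x • gen (j x)) b := by
  have hbr : ∀ x y, FreeAlgebra.lift ℂ (fun x => altScalar x • gen (j x)) (br (fg x) (fg y)) =
      (altScalar x * altScalar y) • ⁅gen (j x), gen (j y)⁆ := fun x y => by
    simp only [br, fg, map_sub, map_mul, FreeAlgebra.lift_ι_apply]
    rw [← Ring.lie_def, smul_lie, lie_smul, smul_smul]
  have hfg : ∀ x, FreeAlgebra.lift ℂ (fun x => altScalar x • gen (j x)) (fg x) =
      altScalar x • gen (j x) := fun x => by
    simp only [fg, FreeAlgebra.lift_ι_apply]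
  cases h with
  | a1 k l =>
    rw [hbr, map_smul, map_sub, hfg, hfg, ← lie_skew, hwp, neg_sub]
    simp only [altScalar]
    rw [← smul_sub, smul_smul, two_zpow_mul_two_zpow, two_inv_mul_two_zpow]
    congr 2; push_cast; ring
  | a2a k l =>
    rw [hbr, map_smul, hfg, hgtwm, smul_smul]
    simp only [altScalar]
    rw [two_zpow_mul_two_zpow, sixteen_mul_two_zpow]
    congr 2; push_cast; ring
  | a2b k l =>
    rw [hbr, map_smul, hfg, ← lie_skew, hgwm, neg_neg, smul_smul]
    simp only [altScalar]
    rw [two_zpow_mul_two_zpow, sixteen_mul_two_zpow]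
    congr 2; push_cast; ring
  | a3a k l =>
    rw [hbr, map_smul, hfg, ← lie_skew, hgtwp, neg_neg, smul_smul]
    simp only [altScalar]
    rw [two_zpow_mul_two_zpow, sixteen_mul_two_zpow]
    congr 2; push_cast; ring
  | a3b k l =>
    rw [hbr, map_smul, hfg, hgwp, smul_smul]
    simp only [altScalar]
    rw [two_zpow_mul_two_zpow, sixteen_mul_two_zpow]
    congr 2; push_cast; ring
  | a4a k l => rw [hbr, hwmwm, smul_zero, map_zero]
  | a4b k l => rw [hbr, hwpwp, smul_zero, map_zero]
  | a4c k l => rw [hbr, hgg, smul_zero, map_zero]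
  | a4d k l => rw [hbr, hgtgt, smul_zero, map_zero]

theorem range_eq_union {α : Type*} (f : Gen → α) :
    Set.range f = (Set.range fun k => f (.wm k)) ∪ (Set.range fun k => f (.wp k)) ∪
      (Set.range fun k => f (.g k)) ∪ (Set.range fun k => f (.gt k)) := by
  ext a
  simp only [Set.mem_range, Set.mem_union]
  constructor
  · rintro ⟨k | k | k | k, rfl⟩ <;> simp
  · rintro (((⟨k, rfl⟩ | ⟨k, rfl⟩) | ⟨k, rfl⟩) | ⟨k, rfl⟩) <;> exact ⟨_, rfl⟩

theorem gen_xp (k : ℤ) : gen (.xp k) = Xp k := rfl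

theorem gen_xm (k : ℤ) : gen (.xm k) = Xm k := rfl

theorem gen_e1 (k : ℤ) : gen (.e1 k) = E1 k := rfl

theorem gen_e2 (k : ℤ) : gen (.e2 k) = E2 k := rfl

theorem lift_rightGen_eq_of_relA ⦃a b : FreeAlgebra ℂ Gen⦄ (h : relA a b) :
    FreeAlgebra.lift ℂ (fun x => altScalar x • gen (rightGen x)) a =
      FreeAlgebra.lift ℂ (fun x => altScalar x • gen (rightGen x)) b := by
  refine lift_eq_of_relA (fun k l => ?_) (fun k l => ?_) (fun k l => ?_) (fun k l => ?_)
    (fun k l => ?_) (fun k l => ?_) (fun k l => ?_) (fun k l => ?_) (fun k l => ?_) h <;>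
    simp only [rightGen, gen_xp, gen_xm, gen_e1, gen_e2]
  · rw [lie_Xp_Xm (by lia)]
    congr 2
  · rw [lie_E2_Xm]
    congr 1; push_cast; ring
  · rw [lie_E1_Xm]
    congr 2; push_cast; ring
  · rw [lie_E2_Xp]
    congr 2; push_cast; ring
  · rw [lie_E1_Xp]
    congr 1; push_cast; ring
  · exact lie_Xm_Xm _ _
  · exact lie_Xp_Xp _ _
  · exact lie_E1_E1 (by lia)
  · exact lie_E2_E2 (by lia)

theorem lift_leftGen_eq_of_relA ⦃a b : FreeAlgebra ℂ Gen⦄ (h : relA a b) :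
    FreeAlgebra.lift ℂ (fun x => altScalar x • gen (leftGen x)) a =
      FreeAlgebra.lift ℂ (fun x => altScalar x • gen (leftGen x)) b := by
  refine lift_eq_of_relA (fun k l => ?_) (fun k l => ?_) (fun k l => ?_) (fun k l => ?_)
    (fun k l => ?_) (fun k l => ?_) (fun k l => ?_) (fun k l => ?_) (fun k l => ?_) h <;>
    simp only [leftGen, gen_xp, gen_xm, gen_e1, gen_e2]
  · rw [lie_Xp_Xm (by lia)]
    congr 2 <;> push_cast <;> ring
  · rw [lie_E2_Xm]
    congr 1; push_cast; ring
  · rw [lie_E1_Xm]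
    congr 2; push_cast; ring
  · rw [lie_E2_Xp]
    congr 2; push_cast; ring
  · rw [lie_E1_Xp]
    congr 1; push_cast; ring
  · exact lie_Xm_Xm _ _
  · exact lie_Xp_Xp _ _
  · exact lie_E1_E1 (by lia)
  · exact lie_E2_E2 (by lia)

end Homomorphism

/-- Proposition 5.4 of the paper: `Ā` is isomorphic, as a `ℂ`-algebra, to the
right alternating subalgebra `U(ĝl₂^{▷,+})` via
`w_{-k} ↦ 2^{1-k}x_{k+1}⁻`, `w_{k+1} ↦ 2^{1-k}x_k⁺`, `g_{k+1} ↦ 2^{3-k}ε_{1,k+1}`,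
`g̃_{k+1} ↦ 2^{3-k}ε_{2,k+1}`, and to the left alternating subalgebra
`U(ĝl₂^{◁,-})` via `w_{-k} ↦ 2^{1-k}x_{-k}⁻`, `w_{k+1} ↦ 2^{1-k}x_{-k-1}⁺`,
`g_{k+1} ↦ 2^{3-k}ε_{1,-k-1}`, `g̃_{k+1} ↦ 2^{3-k}ε_{2,-k-1}`. -/
theorem statement19 :
    (∃ φ : Abar →ₐ[ℂ] Ugl,
      Function.Injective φ ∧
      (∀ k : ℕ, φ (wm k) = (2 : ℂ) ^ (1 - (k : ℤ)) • Xm ((k : ℤ) + 1)) ∧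
      (∀ k : ℕ, φ (wp k) = (2 : ℂ) ^ (1 - (k : ℤ)) • Xp (k : ℤ)) ∧
      (∀ k : ℕ, φ (g k) = (2 : ℂ) ^ (3 - (k : ℤ)) • E1 ((k : ℤ) + 1)) ∧
      (∀ k : ℕ, φ (gt k) = (2 : ℂ) ^ (3 - (k : ℤ)) • E2 ((k : ℤ) + 1)) ∧
      φ.range = Algebra.adjoin ℂ
        ((Set.range fun k : ℕ => Xp (k : ℤ)) ∪ (Set.range fun k : ℕ => Xm ((k : ℤ) + 1)) ∪
          (Set.range fun k : ℕ => E1 ((k : ℤ) + 1)) ∪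
          (Set.range fun k : ℕ => E2 ((k : ℤ) + 1)))) ∧
    (∃ φ : Abar →ₐ[ℂ] Ugl,
      Function.Injective φ ∧
      (∀ k : ℕ, φ (wm k) = (2 : ℂ) ^ (1 - (k : ℤ)) • Xm (-(k : ℤ))) ∧
      (∀ k : ℕ, φ (wp k) = (2 : ℂ) ^ (1 - (k : ℤ)) • Xp (-(k : ℤ) - 1)) ∧
      (∀ k : ℕ, φ (g k) = (2 : ℂ) ^ (3 - (k : ℤ)) • E1 (-(k : ℤ) - 1)) ∧
      (∀ k : ℕ, φ (gt k) = (2 : ℂ) ^ (3 - (k : ℤ)) • E2 (-(k : ℤ) - 1)) ∧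
      φ.range = Algebra.adjoin ℂ
        ((Set.range fun k : ℕ => Xm (-(k : ℤ))) ∪
          (Set.range fun k : ℕ => Xp (-(k : ℤ) - 1)) ∪
          (Set.range fun k : ℕ => E1 (-(k : ℤ) - 1)) ∪
          (Set.range fun k : ℕ => E2 (-(k : ℤ) - 1)))) := by
  obtain ⟨φ, hφ, hgen, hrange⟩ := exists_injective_algHom altScalar_ne_zero rightGen_injective
    (by rintro (_ | _ | _ | _) <;> simp [rightGen]) lift_rightGen_eq_of_relA
  obtain ⟨φ', hφ', hgen', hrange'⟩ := exists_injective_algHom altScalar_ne_zero leftGen_injective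
    (by rintro (_ | _ | _ | _) <;> simp [leftGen]) lift_leftGen_eq_of_relA
  refine ⟨⟨φ, hφ, fun k => hgen (.wm k), fun k => hgen (.wp k), fun k => hgen (.g k),
    fun k => hgen (.gt k), ?_⟩, ⟨φ', hφ', fun k => hgen' (.wm k), fun k => hgen' (.wp k),
    fun k => hgen' (.g k), fun k => hgen' (.gt k), ?_⟩⟩
  · rw [hrange, range_eq_union, Set.union_comm (Set.range fun k => gen (rightGen (.wm k)))]
    rfl
  · rw [hrange', range_eq_union]
    rfl

end AltGl
end
end
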